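/- Lemma D.6 (small-loss bound on occupancy-measure estimation error): In the setting of Algorithm 3, with probability at least 1 − 6δ, simultaneously for every episode t and every collection of transition functions {P_t^x}_{x∈X} with P_t^x ∈ 𝒫_{i_t} for all x (i_t being the epoch of episode t), Σ_{t=1}^T Σ_{x∈X, a∈A} |w^{P_t^x, π_t}(x,a) − w_t(x,a)|·ℓ_t(x,a) = Õ(|X|·√(J·|A|·L_T·ln(1/δ)) + |X|⁵|A|²·ln(1/δ) + |X|⁴|A|·ln²(1/δ)), where w_t = w^{P,π_t} and L_T = Σ_{t=1}^T ⟨w_t, ℓ_t⟩. -/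

import Mathlib

open MeasureTheory Real Finset

/-! Common notions for episodic loop-free adversarial MDPs: occupancy measures,
valid transitions and policies, visit counters and confidence sets. -/

section MDP

variable {X A Ω : Type} [Fintype X] [DecidableEq X] [Fintype A] [DecidableEq A]

/-- Probability of being at state `x` after `k` steps, under transition `P` and
policy `π`, starting from `x0`. -/
noncomputable def reach (P : X → A → X → ℝ) (pol : X → A → ℝ) (x0 : X) :
    ℕ → X → ℝ
  | 0 => fun x => if x = x0 then 1 else 0
  | k + 1 => fun x => ∑ x'' : X, ∑ a : A, reach P pol x0 k x'' * pol x'' a * P x'' a x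

/-- Occupancy-measure marginal `w^{P,π}(x,a)`. -/
noncomputable def occ (layer : X → ℕ) (P : X → A → X → ℝ) (pol : X → A → ℝ)
    (x0 : X) (x : X) (a : A) : ℝ :=
  reach P pol x0 (layer x) x * pol x a

/-- Expected loss `⟨w^{P,π}, ℓ⟩` of policy `π` under transition `P`. -/
noncomputable def lossOf (layer : X → ℕ) (P : X → A → X → ℝ) (pol : X → A → ℝ)
    (x0 : X) (ℓ : X → A → ℝ) : ℝ :=
  ∑ x : X, ∑ a : A, occ layer P pol x0 x a * ℓ x a

/-- A valid loop-free transition function for the layer structure. -/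
def validTrans (layer : X → ℕ) (J : ℕ) (P : X → A → X → ℝ) : Prop :=
  (∀ x a x', 0 ≤ P x a x') ∧ (∀ x a x', P x a x' ≠ 0 → layer x' = layer x + 1) ∧
  (∀ x, layer x < J → ∀ a, ∑ x' : X, P x a x' = 1)

/-- A valid stochastic policy. -/
def validPolicy (pol : X → A → ℝ) : Prop :=
  (∀ x a, 0 ≤ pol x a) ∧ ∀ x, ∑ a : A, pol x a = 1

/-- Number of visits to the state-action pair `(x,a)` during episodes `1..t`. -/
def visits (layer : X → ℕ) (st : ℕ → Ω → ℕ → X) (ac : ℕ → Ω → ℕ → A)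
    (t : ℕ) (x : X) (a : A) (ω : Ω) : ℕ :=
  ∑ τ ∈ Finset.Icc 1 t,
    if st τ ω (layer x) = x ∧ ac τ ω (layer x) = a then 1 else 0

/-- Number of traversals of the triple `(x,a,x')` during episodes `1..t`. -/
def transCount (layer : X → ℕ) (st : ℕ → Ω → ℕ → X) (ac : ℕ → Ω → ℕ → A)
    (t : ℕ) (x : X) (a : A) (x' : X) (ω : Ω) : ℕ :=
  ∑ τ ∈ Finset.Icc 1 t,
    if st τ ω (layer x) = x ∧ ac τ ω (layer x) = a ∧ st τ ω (layer x + 1) = x'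
    then 1 else 0

/-- Empirical transition frequency computed from the first `t0` episodes. -/
noncomputable def empP (layer : X → ℕ) (st : ℕ → Ω → ℕ → X) (ac : ℕ → Ω → ℕ → A)
    (t0 : ℕ) (ω : Ω) (x : X) (a : A) (x' : X) : ℝ :=
  (transCount layer st ac t0 x a x' ω : ℝ) /
    max 1 ((visits layer st ac t0 x a ω : ℕ) : ℝ)

/-- Width `ε_i(x'|x,a)` of the confidence interval built from the first `t0` episodes. -/
noncomputable def confWidth (layer : X → ℕ) (st : ℕ → Ω → ℕ → X)
    (ac : ℕ → Ω → ℕ → A) (T : ℕ) (δ : ℝ) (t0 : ℕ) (ω : Ω)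
    (x : X) (a : A) (x' : X) : ℝ :=
  4 * Real.sqrt (empP layer st ac t0 ω x a x' *
      Real.log ((T * Fintype.card X * Fintype.card A : ℕ) / δ) /
      max 1 ((visits layer st ac t0 x a ω : ℝ) - 1)) +
    28 * Real.log ((T * Fintype.card X * Fintype.card A : ℕ) / δ) /
      (3 * max 1 ((visits layer st ac t0 x a ω : ℝ) - 1))

/-- Membership in the confidence set of transition functions built from the first `t0`
episodes (for `t0 = 0`, i.e. the first epoch, this is the set of all valid transition
functions). -/
def inConf (layer : X → ℕ) (J : ℕ) (st : ℕ → Ω → ℕ → X) (ac : ℕ → Ω → ℕ → A)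
    (T : ℕ) (δ : ℝ) (t0 : ℕ) (ω : Ω) (Ph : X → A → X → ℝ) : Prop :=
  validTrans layer J Ph ∧
  (t0 ≠ 0 → ∀ x a x', layer x' = layer x + 1 →
    |Ph x a x' - empP layer st ac t0 ω x a x'| ≤ confWidth layer st ac T δ t0 ω x a x')

end MDP

set_option linter.unusedSectionVars false
set_option linter.unusedVariables false

set_option linter.unusedSectionVars false
section PartA

variable {X A : Type} [Fintype X] [DecidableEq X] [Fintype A] [DecidableEq A]

noncomputable def tmat (P : X → A → X → ℝ) (pol : X → A → ℝ) : Matrix X X ℝ :=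
  fun x x' => ∑ a : A, pol x a * P x a x'

noncomputable def gmat (J : ℕ) (P : X → A → X → ℝ) (pol : X → A → ℝ) : Matrix X X ℝ :=
  ∑ k ∈ Finset.range (J + 1), (tmat P pol) ^ k

theorem reach_eq_pow (P : X → A → X → ℝ) (pol : X → A → ℝ) (x0 : X) (k : ℕ) (x : X) :
    reach P pol x0 k x = ((tmat P pol) ^ k) x0 x := by
  induction k generalizing x with
  | zero => simp [reach, Matrix.one_apply, eq_comm]
  | succ k ih =>
    rw [pow_succ, Matrix.mul_apply]
    simp only [reach, tmat, Finset.mul_sum]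
    refine Finset.sum_congr rfl fun y _ => Finset.sum_congr rfl fun a _ => ?_
    rw [ih]; ring

theorem tmat_nonneg {layer : X → ℕ} {J : ℕ} {P : X → A → X → ℝ} {pol : X → A → ℝ}
    (hP : validTrans layer J P) (hpol : validPolicy pol) (x x' : X) : 0 ≤ tmat P pol x x' :=
  Finset.sum_nonneg fun a _ => mul_nonneg (hpol.1 x a) (hP.1 x a x')

theorem tmat_layer {layer : X → ℕ} {J : ℕ} {P : X → A → X → ℝ} {pol : X → A → ℝ}
    (hP : validTrans layer J P) (x x' : X) (h : tmat P pol x x' ≠ 0) :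
    layer x' = layer x + 1 := by
  by_contra hne
  apply h
  refine Finset.sum_eq_zero fun a _ => ?_
  have : P x a x' = 0 := by
    by_contra h2
    exact hne (hP.2.1 x a x' h2)
  rw [this, mul_zero]

theorem pow_nonneg' {layer : X → ℕ} {J : ℕ} {P : X → A → X → ℝ} {pol : X → A → ℝ}
    (hP : validTrans layer J P) (hpol : validPolicy pol) (k : ℕ) (x x' : X) :
    0 ≤ ((tmat P pol) ^ k) x x' := by
  induction k generalizing x' with
  | zero => simp only [pow_zero, Matrix.one_apply]; split_ifs <;> norm_num
  | succ k ih =>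
    rw [pow_succ, Matrix.mul_apply]
    exact Finset.sum_nonneg fun y _ => mul_nonneg (ih y) (tmat_nonneg hP hpol _ _)

theorem pow_layer {layer : X → ℕ} {J : ℕ} {P : X → A → X → ℝ} {pol : X → A → ℝ}
    (hP : validTrans layer J P) (k : ℕ) (x x' : X) (h : ((tmat P pol) ^ k) x x' ≠ 0) :
    layer x' = layer x + k := by
  induction k generalizing x' with
  | zero =>
    by_contra hne
    apply h
    rw [pow_zero, Matrix.one_apply, if_neg]
    rintro rfl; simp at hne
  | succ k ih =>
    rw [pow_succ, Matrix.mul_apply] at h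
    obtain ⟨y, _, hy⟩ := Finset.exists_ne_zero_of_sum_ne_zero h
    have h1 := ih y (left_ne_zero_of_mul hy)
    have h2 := tmat_layer hP y x' (right_ne_zero_of_mul hy)
    omega

theorem tmat_row {layer : X → ℕ} {J : ℕ} {P : X → A → X → ℝ} {pol : X → A → ℝ}
    (hP : validTrans layer J P) (hpol : validPolicy pol) (hle : ∀ x, layer x ≤ J) (x : X) :
    ∑ x', tmat P pol x x' ≤ 1 := by
  unfold tmat
  rw [Finset.sum_comm]
  simp_rw [← Finset.mul_sum]
  rcases lt_or_eq_of_le (hle x) with h | h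
  · rw [Finset.sum_congr rfl (fun a _ => by rw [hP.2.2 x h a, mul_one]), hpol.2 x]
  · have : ∀ a x', P x a x' = 0 := by
      intro a x'
      by_contra h2
      have := hP.2.1 x a x' h2
      have := hle x'
      omega
    simp [this]

theorem pow_row {layer : X → ℕ} {J : ℕ} {P : X → A → X → ℝ} {pol : X → A → ℝ}
    (hP : validTrans layer J P) (hpol : validPolicy pol) (hle : ∀ x, layer x ≤ J) (k : ℕ) (x : X) :
    ∑ x', ((tmat P pol) ^ k) x x' ≤ 1 := by
  induction k with
  | zero => simp [Matrix.one_apply]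
  | succ k ih =>
    simp_rw [pow_succ, Matrix.mul_apply]
    rw [Finset.sum_comm]
    simp_rw [← Finset.mul_sum]
    refine le_trans (Finset.sum_le_sum fun y _ => ?_) ih
    exact mul_le_of_le_one_right (pow_nonneg' hP hpol _ _ _) (tmat_row hP hpol hle y)

theorem pow_top {layer : X → ℕ} {J : ℕ} {P : X → A → X → ℝ} {pol : X → A → ℝ}
    (hP : validTrans layer J P) (hle : ∀ x, layer x ≤ J) : (tmat P pol) ^ (J + 1) = 0 := by
  ext x x'
  by_contra h
  have h1 := pow_layer hP (J + 1) x x' h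
  have := hle x'
  omega

theorem gmat_apply (J : ℕ) (P : X → A → X → ℝ) (pol : X → A → ℝ) (x x' : X) :
    gmat J P pol x x' = ∑ k ∈ Finset.range (J + 1), ((tmat P pol) ^ k) x x' := by
  unfold gmat
  rw [Matrix.sum_apply]

theorem gmat_nonneg {layer : X → ℕ} {J : ℕ} {P : X → A → X → ℝ} {pol : X → A → ℝ}
    (hP : validTrans layer J P) (hpol : validPolicy pol) (x x' : X) :
    0 ≤ gmat J P pol x x' := by
  rw [gmat_apply]
  exact Finset.sum_nonneg fun k _ => pow_nonneg' hP hpol k _ _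

theorem gmat_eq_pow {layer : X → ℕ} {J : ℕ} {P : X → A → X → ℝ} {pol : X → A → ℝ}
    (hP : validTrans layer J P) (hle : ∀ x, layer x ≤ J) (x x' : X) (j : ℕ)
    (hj : layer x' = layer x + j) :
    gmat J P pol x x' = ((tmat P pol) ^ j) x x' := by
  rw [gmat_apply]
  refine Finset.sum_eq_single j ?_ ?_
  · intro k _ hk
    by_contra h
    have := pow_layer hP k x x' h
    omega
  · intro h
    have := hle x'
    simp at h
    omega

theorem gmat_le_one {layer : X → ℕ} {J : ℕ} {P : X → A → X → ℝ} {pol : X → A → ℝ}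
    (hP : validTrans layer J P) (hpol : validPolicy pol) (hle : ∀ x, layer x ≤ J) (x x' : X) :
    gmat J P pol x x' ≤ 1 := by
  by_cases h : layer x ≤ layer x'
  · rw [gmat_eq_pow hP hle x x' (layer x' - layer x) (by omega)]
    refine le_trans ?_ (pow_row hP hpol hle (layer x' - layer x) x)
    exact Finset.single_le_sum (f := fun x' => ((tmat P pol) ^ (layer x' - layer x)) x x')
      (s := {x'}) (fun y _ => pow_nonneg' hP hpol _ _ _) (Finset.mem_singleton_self _) |>.trans (by
        simp only [Finset.sum_singleton]
        exact Finset.single_le_sum (f := fun y => ((tmat P pol) ^ (layer x' - layer x)) x y)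
          (fun y _ => pow_nonneg' hP hpol _ _ _) (Finset.mem_univ x'))
  · rw [gmat_apply, Finset.sum_eq_zero]
    · norm_num
    · intro k _
      by_contra h2
      have := pow_layer hP k x x' h2
      omega

theorem gmat_row {layer : X → ℕ} {J : ℕ} {P : X → A → X → ℝ} {pol : X → A → ℝ}
    (hP : validTrans layer J P) (hpol : validPolicy pol) (hle : ∀ x, layer x ≤ J) (x : X) :
    ∑ x', gmat J P pol x x' ≤ J + 1 := by
  simp_rw [gmat_apply]
  rw [Finset.sum_comm]
  refine le_trans (Finset.sum_le_sum fun k _ => pow_row hP hpol hle k x) ?_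
  simp

theorem gmat_right {layer : X → ℕ} {J : ℕ} {P : X → A → X → ℝ} {pol : X → A → ℝ}
    (hP : validTrans layer J P) (hle : ∀ x, layer x ≤ J) :
    gmat J P pol * (1 - tmat P pol) = 1 := by
  unfold gmat
  rw [geom_sum_mul_neg, pow_top hP hle, sub_zero]

theorem gmat_left {layer : X → ℕ} {J : ℕ} {P : X → A → X → ℝ} {pol : X → A → ℝ}
    (hP : validTrans layer J P) (hle : ∀ x, layer x ≤ J) :
    (1 - tmat P pol) * gmat J P pol = 1 := by
  unfold gmat
  rw [mul_neg_geom_sum, pow_top hP hle, sub_zero]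

theorem gmat_diff {layer : X → ℕ} {J : ℕ} {P Q : X → A → X → ℝ} {pol : X → A → ℝ}
    (hP : validTrans layer J P) (hQ : validTrans layer J Q) (hle : ∀ x, layer x ≤ J) :
    gmat J Q pol - gmat J P pol =
      gmat J P pol * (tmat Q pol - tmat P pol) * gmat J Q pol := by
  have h1 := gmat_right (pol := pol) hP hle
  have h2 := gmat_left (pol := pol) hQ hle
  have : tmat Q pol - tmat P pol = (1 - tmat P pol) - (1 - tmat Q pol) := by abel
  rw [this, mul_sub, h1, sub_mul, one_mul, mul_assoc, h2, mul_one]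

theorem tmat_mul_gmat_le {layer : X → ℕ} {J : ℕ} {P : X → A → X → ℝ} {pol : X → A → ℝ}
    (hP : validTrans layer J P) (hle : ∀ x, layer x ≤ J) (x x' : X) :
    (tmat P pol * gmat J P pol) x x' ≤ gmat J P pol x x' := by
  have h := gmat_left (pol := pol) hP hle
  rw [sub_mul, one_mul] at h
  have h2 : tmat P pol * gmat J P pol = gmat J P pol - 1 := by rw [← h]; abel
  rw [h2, Matrix.sub_apply, Matrix.one_apply]
  split_ifs <;> linarith

theorem pow_mul_gmat_le {layer : X → ℕ} {J : ℕ} {P : X → A → X → ℝ} {pol : X → A → ℝ}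
    (hP : validTrans layer J P) (hpol : validPolicy pol) (hle : ∀ x, layer x ≤ J) (k : ℕ)
    (x x' : X) :
    ((tmat P pol) ^ k * gmat J P pol) x x' ≤ gmat J P pol x x' := by
  induction k with
  | zero => simp
  | succ k ih =>
    refine le_trans ?_ ih
    rw [pow_succ, mul_assoc, Matrix.mul_apply, Matrix.mul_apply]
    exact Finset.sum_le_sum fun y _ =>
      mul_le_mul_of_nonneg_left (tmat_mul_gmat_le hP hle y x') (pow_nonneg' hP hpol _ _ _)

theorem gmat_layer_sum {layer : X → ℕ} {J : ℕ} {P : X → A → X → ℝ} {pol : X → A → ℝ}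
    (hP : validTrans layer J P) (hpol : validPolicy pol) (hle : ∀ x, layer x ≤ J)
    (x0 : X) (h0 : layer x0 = 0) (k : ℕ) (x : X) :
    ∑ u ∈ Finset.univ.filter (fun u => layer u = k), gmat J P pol x0 u * gmat J P pol u x
      ≤ gmat J P pol x0 x := by
  refine le_trans ?_ (pow_mul_gmat_le hP hpol hle k x0 x)
  rw [Matrix.mul_apply]
  refine le_trans (Finset.sum_le_sum (g := fun u => ((tmat P pol) ^ k) x0 u * gmat J P pol u x)
    fun u hu => ?_) ?_
  · rw [gmat_eq_pow hP hle x0 u k (by simp at hu; omega)]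
  · exact Finset.sum_le_sum_of_subset_of_nonneg (Finset.filter_subset _ _)
      fun u _ _ => mul_nonneg (pow_nonneg' hP hpol _ _ _) (gmat_nonneg hP hpol _ _)

theorem gmat_mul_le {layer : X → ℕ} {J : ℕ} {P : X → A → X → ℝ} {pol : X → A → ℝ}
    (hP : validTrans layer J P) (hpol : validPolicy pol) (hle : ∀ x, layer x ≤ J)
    (x0 : X) (h0 : layer x0 = 0) (u x : X) :
    gmat J P pol x0 u * gmat J P pol u x ≤ gmat J P pol x0 x := by
  refine le_trans ?_ (gmat_layer_sum hP hpol hle x0 h0 (layer u) x)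
  exact Finset.single_le_sum (f := fun u => gmat J P pol x0 u * gmat J P pol u x)
    (fun y _ => mul_nonneg (gmat_nonneg hP hpol _ _) (gmat_nonneg hP hpol _ _)) (by simp)

theorem occ_eq {layer : X → ℕ} {J : ℕ} {P : X → A → X → ℝ} {pol : X → A → ℝ}
    (hP : validTrans layer J P) (hle : ∀ x, layer x ≤ J)
    (x0 : X) (h0 : layer x0 = 0) (x : X) (a : A) :
    occ layer P pol x0 x a = gmat J P pol x0 x * pol x a := by
  unfold occ
  rw [reach_eq_pow, gmat_eq_pow hP hle x0 x (layer x) (by omega)]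

end PartA


section PartB

variable {X A : Type} [Fintype X] [DecidableEq X] [Fintype A] [DecidableEq A]

theorem abs_gmat_diff_le {layer : X → ℕ} {J : ℕ} {P Q : X → A → X → ℝ} {pol : X → A → ℝ}
    (hP : validTrans layer J P) (hQ : validTrans layer J Q) (hpol : validPolicy pol)
    (hle : ∀ x, layer x ≤ J) (e : X → A → X → ℝ) (he : ∀ x a x', |Q x a x' - P x a x'| ≤ e x a x')
    (y x : X) :
    |gmat J Q pol y x - gmat J P pol y x| ≤
      ∑ u, ∑ u', gmat J P pol y u * tmat e pol u u' * gmat J Q pol u' x := by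
  rw [← Matrix.sub_apply, gmat_diff hP hQ hle, Matrix.mul_assoc, Matrix.mul_apply]
  refine (Finset.abs_sum_le_sum_abs _ _).trans (Finset.sum_le_sum fun u _ => ?_)
  rw [abs_mul, abs_of_nonneg (gmat_nonneg hP hpol _ _), Matrix.mul_apply]
  simp_rw [mul_assoc]
  rw [← Finset.mul_sum]
  refine mul_le_mul_of_nonneg_left ?_ (gmat_nonneg hP hpol _ _)
  refine (Finset.abs_sum_le_sum_abs _ _).trans (Finset.sum_le_sum fun u' _ => ?_)
  rw [abs_mul, abs_of_nonneg (gmat_nonneg hQ hpol _ _)]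
  refine mul_le_mul_of_nonneg_right ?_ (gmat_nonneg hQ hpol _ _)
  rw [Matrix.sub_apply]
  unfold tmat
  rw [← Finset.sum_sub_distrib]
  refine (Finset.abs_sum_le_sum_abs _ _).trans (Finset.sum_le_sum fun b _ => ?_)
  rw [← mul_sub, abs_mul, abs_of_nonneg (hpol.1 u b)]
  exact mul_le_mul_of_nonneg_left (he u b u') (hpol.1 u b)

theorem abs_gmat_diff_le2 {layer : X → ℕ} {J : ℕ} {P Q : X → A → X → ℝ} {pol : X → A → ℝ}
    (hP : validTrans layer J P) (hQ : validTrans layer J Q) (hpol : validPolicy pol)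
    (hle : ∀ x, layer x ≤ J) (e : X → A → X → ℝ) (he : ∀ x a x', |Q x a x' - P x a x'| ≤ e x a x')
    (y x : X) :
    |gmat J Q pol y x - gmat J P pol y x| ≤
      ∑ u, ∑ u', gmat J P pol y u * tmat e pol u u' *
        (gmat J P pol u' x + ∑ v, ∑ v', gmat J P pol u' v * tmat e pol v v') := by
  have hE : ∀ u u', 0 ≤ tmat e pol u u' := fun u u' => Finset.sum_nonneg fun a _ =>
    mul_nonneg (hpol.1 _ _) ((abs_nonneg _).trans (he _ _ _))
  refine (abs_gmat_diff_le hP hQ hpol hle e he y x).trans ?_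
  refine Finset.sum_le_sum fun u _ => Finset.sum_le_sum fun u' _ => ?_
  refine mul_le_mul_of_nonneg_left ?_ (mul_nonneg (gmat_nonneg hP hpol _ _) (hE _ _))
  have h1 := abs_gmat_diff_le hP hQ hpol hle e he u' x
  have h2 : ∑ u, ∑ u'', gmat J P pol u' u * tmat e pol u u'' * gmat J Q pol u'' x ≤
      ∑ v, ∑ v', gmat J P pol u' v * tmat e pol v v' := by
    refine Finset.sum_le_sum fun v _ => Finset.sum_le_sum fun v' _ => ?_
    exact mul_le_of_le_one_right (mul_nonneg (gmat_nonneg hP hpol _ _) (hE _ _))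
      (gmat_le_one hQ hpol hle _ _)
  have h3 := le_abs_self (gmat J Q pol u' x - gmat J P pol u' x)
  linarith

noncomputable def lbar (pol : X → A → ℝ) (l : X → A → ℝ) (x : X) : ℝ := ∑ a, pol x a * l x a

noncomputable def Vfun (J : ℕ) (P : X → A → X → ℝ) (pol : X → A → ℝ) (l : X → A → ℝ) (u : X) : ℝ :=
  ∑ x, gmat J P pol u x * lbar pol l x

theorem lbar_nonneg {pol l : X → A → ℝ} (hpol : validPolicy pol)
    (hl : ∀ x a, l x a ∈ Set.Icc (0:ℝ) 1) (x : X) : 0 ≤ lbar pol l x :=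
  Finset.sum_nonneg fun a _ => mul_nonneg (hpol.1 _ _) (hl _ _).1

theorem lbar_le_one {pol l : X → A → ℝ} (hpol : validPolicy pol)
    (hl : ∀ x a, l x a ∈ Set.Icc (0:ℝ) 1) (x : X) : lbar pol l x ≤ 1 := by
  rw [← hpol.2 x]
  exact Finset.sum_le_sum fun a _ => mul_le_of_le_one_right (hpol.1 _ _) (hl _ _).2

theorem Vfun_nonneg {layer : X → ℕ} {J : ℕ} {P : X → A → X → ℝ} {pol l : X → A → ℝ}
    (hP : validTrans layer J P) (hpol : validPolicy pol)
    (hl : ∀ x a, l x a ∈ Set.Icc (0:ℝ) 1) (u : X) : 0 ≤ Vfun J P pol l u :=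
  Finset.sum_nonneg fun x _ => mul_nonneg (gmat_nonneg hP hpol _ _) (lbar_nonneg hpol hl _)

theorem Vfun_le_J {layer : X → ℕ} {J : ℕ} {P : X → A → X → ℝ} {pol l : X → A → ℝ}
    (hP : validTrans layer J P) (hpol : validPolicy pol) (hle : ∀ x, layer x ≤ J)
    (hl : ∀ x a, l x a ∈ Set.Icc (0:ℝ) 1) (u : X) : Vfun J P pol l u ≤ J + 1 :=
  (Finset.sum_le_sum fun x _ => mul_le_of_le_one_right (gmat_nonneg hP hpol _ _)
    (lbar_le_one hpol hl _)).trans (gmat_row hP hpol hle u)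

theorem Vfun_le_card {layer : X → ℕ} {J : ℕ} {P : X → A → X → ℝ} {pol l : X → A → ℝ}
    (hP : validTrans layer J P) (hpol : validPolicy pol) (hle : ∀ x, layer x ≤ J)
    (hl : ∀ x a, l x a ∈ Set.Icc (0:ℝ) 1) (u : X) : Vfun J P pol l u ≤ Fintype.card X := by
  refine (Finset.sum_le_sum (g := fun _ => (1:ℝ)) fun x _ => ?_).trans (by simp)
  exact mul_le_one₀ (gmat_le_one hP hpol hle _ _) (lbar_nonneg hpol hl _) (lbar_le_one hpol hl _)

theorem lossOf_eq {layer : X → ℕ} {J : ℕ} {P : X → A → X → ℝ} {pol l : X → A → ℝ}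
    (hP : validTrans layer J P) (hle : ∀ x, layer x ≤ J) (x0 : X) (h0 : layer x0 = 0) :
    lossOf layer P pol x0 l = Vfun J P pol l x0 := by
  unfold lossOf Vfun lbar
  refine Finset.sum_congr rfl fun x _ => ?_
  rw [Finset.mul_sum]
  refine Finset.sum_congr rfl fun a _ => ?_
  rw [occ_eq hP hle x0 h0, mul_assoc]

theorem per_episode {layer : X → ℕ} {J : ℕ} {P : X → A → X → ℝ} {Q : X → X → A → X → ℝ}
    {pol l : X → A → ℝ}
    (hP : validTrans layer J P) (hQ : ∀ x, validTrans layer J (Q x)) (hpol : validPolicy pol)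
    (hle : ∀ x, layer x ≤ J) (hl : ∀ x a, l x a ∈ Set.Icc (0:ℝ) 1)
    (e : X → A → X → ℝ) (he : ∀ y x a x', |Q y x a x' - P x a x'| ≤ e x a x')
    (x0 : X) (h0 : layer x0 = 0) :
    ∑ x, ∑ a, |occ layer (Q x) pol x0 x a - occ layer P pol x0 x a| * l x a ≤
      ∑ u, ∑ u', gmat J P pol x0 u * tmat e pol u u' *
        (Vfun J P pol l u' +
          Fintype.card X * ∑ v, ∑ v', gmat J P pol u' v * tmat e pol v v') := by
  have hE : ∀ [Nonempty X], ∀ u u', 0 ≤ tmat e pol u u' := fun u u' =>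
    Finset.sum_nonneg fun a _ =>
    mul_nonneg (hpol.1 _ _) ((abs_nonneg _).trans (he x0 _ _ _))
  haveI : Nonempty X := ⟨x0⟩
  have h1 : ∀ x, ∑ a, |occ layer (Q x) pol x0 x a - occ layer P pol x0 x a| * l x a =
      |gmat J (Q x) pol x0 x - gmat J P pol x0 x| * lbar pol l x := by
    intro x
    unfold lbar
    rw [Finset.mul_sum]
    refine Finset.sum_congr rfl fun a _ => ?_
    rw [occ_eq hP hle x0 h0, occ_eq (hQ x) hle x0 h0, ← sub_mul, abs_mul,
      abs_of_nonneg (hpol.1 x a), mul_assoc]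
  simp_rw [h1]
  have h2 : ∀ x, |gmat J (Q x) pol x0 x - gmat J P pol x0 x| * lbar pol l x ≤
      ∑ u, ∑ u', gmat J P pol x0 u * tmat e pol u u' *
        (gmat J P pol u' x * lbar pol l x +
          ∑ v, ∑ v', gmat J P pol u' v * tmat e pol v v') := by
    intro x
    refine (mul_le_mul_of_nonneg_right (abs_gmat_diff_le2 hP (hQ x) hpol hle e (he x) x0 x)
      (lbar_nonneg hpol hl x)).trans ?_
    rw [Finset.sum_mul]
    refine Finset.sum_le_sum fun u _ => ?_
    rw [Finset.sum_mul]
    refine Finset.sum_le_sum fun u' _ => ?_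
    rw [mul_assoc, add_mul]
    refine mul_le_mul_of_nonneg_left ?_ (mul_nonneg (gmat_nonneg hP hpol _ _) (hE _ _))
    have : 0 ≤ ∑ v, ∑ v', gmat J P pol u' v * tmat e pol v v' :=
      Finset.sum_nonneg fun _ _ => Finset.sum_nonneg fun _ _ =>
        mul_nonneg (gmat_nonneg hP hpol _ _) (hE _ _)
    have := mul_le_of_le_one_right this (lbar_le_one hpol hl x)
    linarith
  refine (Finset.sum_le_sum fun x _ => h2 x).trans (le_of_eq ?_)
  rw [Finset.sum_comm]
  refine Finset.sum_congr rfl fun u _ => ?_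
  rw [Finset.sum_comm]
  refine Finset.sum_congr rfl fun u' _ => ?_
  rw [← Finset.mul_sum, Finset.sum_add_distrib]
  simp [Vfun]

noncomputable def ebd (layer : X → ℕ) (C : ℝ) (P : X → A → X → ℝ) (r : X → A → ℝ)
    (u : X) (b : A) (u' : X) : ℝ :=
  if layer u' = layer u + 1 then C * (√(P u b u' * r u b) + r u b) else 0

theorem prod_bound {p r p' r' : ℝ} (hp : 0 ≤ p) (hp1 : p ≤ 1) (hr : 0 ≤ r) (hr1 : r ≤ 1)
    (hp' : 0 ≤ p') (hp1' : p' ≤ 1) (hr' : 0 ≤ r') (hr1' : r' ≤ 1) :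
    (√(p * r) + r) * (√(p' * r') + r') ≤ 3 * r + p * r' := by
  have h1 : √(p * r) * √(p' * r') ≤ (p' * r + p * r') / 2 := by
    have e : √(p * r) * √(p' * r') = √(p' * r) * √(p * r') := by
      rw [← Real.sqrt_mul (by positivity), ← Real.sqrt_mul (by positivity)]; ring_nf
    rw [e]
    have a := Real.sq_sqrt (show 0 ≤ p' * r by positivity)
    have b := Real.sq_sqrt (show 0 ≤ p * r' by positivity)
    nlinarith [sq_nonneg (√(p' * r) - √(p * r'))]
  have h2 : √(p * r) * r' ≤ (r + p * r') / 2 := by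
    have e : √(p * r) * r' = √(r * r') * √(p * r') := by
      rw [← Real.sqrt_mul (by positivity)]
      rw [show r * r' * (p * r') = (p * r) * (r' ^ 2) by ring,
        Real.sqrt_mul (show 0 ≤ p * r by positivity) (r' ^ 2), Real.sqrt_sq hr']
    rw [e]
    have a := Real.sq_sqrt (show 0 ≤ r * r' by positivity)
    have b := Real.sq_sqrt (show 0 ≤ p * r' by positivity)
    nlinarith [sq_nonneg (√(r * r') - √(p * r')), mul_le_of_le_one_right hr hr1']
  have h3 : √(p' * r') ≤ 1 := by
    rw [Real.sqrt_le_one]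
    exact mul_le_one₀ hp1' hr' hr1'
  have h4 : p' * r ≤ r := mul_le_of_le_one_left hr hp1'
  nlinarith [mul_le_of_le_one_right hr h3, mul_le_of_le_one_right hr hr1']

theorem trans_le_one {layer : X → ℕ} {J : ℕ} {P : X → A → X → ℝ}
    (hP : validTrans layer J P) (hle : ∀ x, layer x ≤ J) (x : X) (a : A) (x' : X) :
    P x a x' ≤ 1 := by
  by_cases h : layer x < J
  · rw [← hP.2.2 x h a]
    exact Finset.single_le_sum (f := fun y => P x a y) (fun y _ => hP.1 _ _ _) (Finset.mem_univ x')
  · by_contra h2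
    have h3 : P x a x' ≠ 0 := by intro h4; rw [h4] at h2; norm_num at h2
    have := hP.2.1 x a x' h3
    have := hle x'
    omega

theorem ebd_nonneg {layer : X → ℕ} {P : X → A → X → ℝ} {C : ℝ} (hC : 0 ≤ C) {r : X → A → ℝ}
    (hr : ∀ u b, 0 ≤ r u b) (u : X) (b : A) (u' : X) : 0 ≤ ebd layer C P r u b u' := by
  unfold ebd
  split_ifs
  · have := hr u b
    positivity
  · exact le_rfl

theorem ebd_le {layer : X → ℕ} {P : X → A → X → ℝ} {C : ℝ} (hC : 0 ≤ C) {r : X → A → ℝ}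
    (hr : ∀ u b, 0 ≤ r u b) (u : X) (b : A) (u' : X) :
    ebd layer C P r u b u' ≤ C * (√(P u b u' * r u b) + r u b) := by
  unfold ebd
  split_ifs
  · exact le_rfl
  · have := hr u b
    positivity

theorem tmat_prod {layer : X → ℕ} {J : ℕ} {P : X → A → X → ℝ} {pol : X → A → ℝ}
    (hP : validTrans layer J P) (hpol : validPolicy pol) (hle : ∀ x, layer x ≤ J)
    {C : ℝ} (hC : 0 ≤ C) {r : X → A → ℝ} (hr : ∀ u b, 0 ≤ r u b) (hr1 : ∀ u b, r u b ≤ 1)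
    (u u' v v' : X) :
    tmat (ebd layer C P r) pol u u' * tmat (ebd layer C P r) pol v v' ≤
      C ^ 2 * (3 * lbar pol r u + tmat P pol u u' * lbar pol r v) := by
  have key : ∀ b c, (pol u b * ebd layer C P r u b u') * (pol v c * ebd layer C P r v c v') ≤
      C ^ 2 * (3 * ((pol u b * r u b) * pol v c) +
        (pol u b * P u b u') * (pol v c * r v c)) := by
    intro b c
    have h1 : ebd layer C P r u b u' * ebd layer C P r v c v' ≤
        C ^ 2 * (3 * r u b + P u b u' * r v c) := by
      refine (mul_le_mul (ebd_le hC hr u b u') (ebd_le hC hr v c v')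
        (ebd_nonneg hC hr _ _ _) ?_).trans ?_
      · have := hr u b
        positivity
      · have := prod_bound (hP.1 u b u') (trans_le_one hP hle u b u') (hr u b) (hr1 u b)
          (hP.1 v c v') (trans_le_one hP hle v c v') (hr v c) (hr1 v c)
        nlinarith [mul_le_mul_of_nonneg_left this (sq_nonneg C)]
    have := mul_le_mul_of_nonneg_left h1 (mul_nonneg (hpol.1 u b) (hpol.1 v c))
    nlinarith [this]
  unfold tmat
  rw [Finset.sum_mul_sum]
  refine (Finset.sum_le_sum fun b _ => Finset.sum_le_sum fun c _ => key b c).trans (le_of_eq ?_)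
  simp_rw [← Finset.mul_sum, Finset.sum_add_distrib, ← Finset.mul_sum]
  rw [hpol.2 v]
  unfold lbar
  simp_rw [← Finset.sum_mul]
  ring

theorem second_order {layer : X → ℕ} {J : ℕ} {P : X → A → X → ℝ} {pol : X → A → ℝ}
    (hP : validTrans layer J P) (hpol : validPolicy pol) (hle : ∀ x, layer x ≤ J)
    (x0 : X) (h0 : layer x0 = 0)
    {C : ℝ} (hC : 0 ≤ C) {r : X → A → ℝ} (hr : ∀ u b, 0 ≤ r u b) (hr1 : ∀ u b, r u b ≤ 1) :
    ∑ u, ∑ u', gmat J P pol x0 u * tmat (ebd layer C P r) pol u u' *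
      ∑ v, ∑ v', gmat J P pol u' v * tmat (ebd layer C P r) pol v v' ≤
    4 * C ^ 2 * (Fintype.card X : ℝ) ^ 3 * ∑ u, gmat J P pol x0 u * lbar pol r u := by
  have hrr : ∀ u b, r u b ∈ Set.Icc (0:ℝ) 1 := fun u b => ⟨hr u b, hr1 u b⟩
  have hcard : (1:ℝ) ≤ Fintype.card X := by
    exact_mod_cast Fintype.card_pos_iff.2 ⟨x0⟩
  set n : ℝ := (Fintype.card X : ℝ)
  set R := ∑ u, gmat J P pol x0 u * lbar pol r u with hR
  have hR0 : 0 ≤ R := Finset.sum_nonneg fun u _ =>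
    mul_nonneg (gmat_nonneg hP hpol _ _) (lbar_nonneg hpol hrr u)
  calc _ ≤ ∑ u, ∑ u', ∑ v, ∑ v' : X, gmat J P pol x0 u * gmat J P pol u' v *
        (C ^ 2 * (3 * lbar pol r u + tmat P pol u u' * lbar pol r v)) := by
        refine Finset.sum_le_sum fun u _ => Finset.sum_le_sum fun u' _ => ?_
        rw [Finset.mul_sum]
        refine Finset.sum_le_sum fun v _ => ?_
        rw [Finset.mul_sum]
        refine Finset.sum_le_sum fun v' _ => ?_
        have := mul_le_mul_of_nonneg_left (tmat_prod hP hpol hle hC hr hr1 u u' v v')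
          (mul_nonneg (gmat_nonneg hP hpol x0 u) (gmat_nonneg hP hpol u' v))
        linarith
    _ = C ^ 2 * (3 * n * (∑ u, (gmat J P pol x0 u * lbar pol r u) * ∑ u', ∑ v, gmat J P pol u' v)
          + n * ∑ u, ∑ v, (gmat J P pol x0 u * (tmat P pol * gmat J P pol) u v) *
            lbar pol r v) := by
        simp only [Finset.sum_const, Finset.card_univ, nsmul_eq_mul, Matrix.mul_apply]
        simp only [Finset.mul_sum, Finset.sum_mul, mul_add, Finset.sum_add_distrib]
        congr 1
        · refine Finset.sum_congr rfl fun u _ => Finset.sum_congr rfl fun u' _ =>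
            Finset.sum_congr rfl fun v _ => ?_
          ring
        · refine Finset.sum_congr rfl fun u _ => ?_
          rw [Finset.sum_comm]
          refine Finset.sum_congr rfl fun u' _ =>
            Finset.sum_congr rfl fun v _ => ?_
          ring
    _ ≤ C ^ 2 * (3 * n * (R * (n * n)) + n * (n * R)) := by
        refine mul_le_mul_of_nonneg_left ?_ (sq_nonneg C)
        refine add_le_add ?_ ?_
        · refine mul_le_mul_of_nonneg_left ?_ (by positivity)
          rw [← Finset.sum_mul]
          refine mul_le_mul_of_nonneg_left ?_ hR0
          refine (Finset.sum_le_sum (g := fun _ => n) fun u' _ => ?_).trans (by simp [n])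
          exact (Finset.sum_le_sum (g := fun _ => (1:ℝ)) fun v _ =>
            gmat_le_one hP hpol hle _ _).trans (by simp [n])
        · refine mul_le_mul_of_nonneg_left ?_ (by positivity)
          refine (Finset.sum_le_sum (g := fun _ => R) fun u _ => ?_).trans (by simp [n])
          refine Finset.sum_le_sum fun v _ => ?_
          refine mul_le_mul_of_nonneg_right ?_ (lbar_nonneg hpol hrr v)
          exact (mul_le_mul_of_nonneg_left (tmat_mul_gmat_le hP hle u v)
            (gmat_nonneg hP hpol _ _)).trans (gmat_mul_le hP hpol hle x0 h0 u v)
    _ ≤ _ := by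
        have h1 : n * (n * R) ≤ n ^ 3 * R := by
          have : n ^ 2 ≤ n ^ 3 := pow_le_pow_right₀ hcard (by norm_num)
          nlinarith [mul_le_mul_of_nonneg_right this hR0]
        nlinarith [mul_le_mul_of_nonneg_left h1 (sq_nonneg C)]

theorem first_order {layer : X → ℕ} {J : ℕ} {P : X → A → X → ℝ} {pol l : X → A → ℝ}
    (hP : validTrans layer J P) (hpol : validPolicy pol) (hle : ∀ x, layer x ≤ J)
    (hl : ∀ x a, l x a ∈ Set.Icc (0:ℝ) 1) (x0 : X)
    {C : ℝ} (hC : 0 ≤ C) {r : X → A → ℝ} (hr : ∀ u b, 0 ≤ r u b) (hr1 : ∀ u b, r u b ≤ 1) :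
    ∑ u, ∑ u', gmat J P pol x0 u * tmat (ebd layer C P r) pol u u' * Vfun J P pol l u' ≤
    C * (∑ u, ∑ b, ∑ u' ∈ Finset.univ.filter (fun u' => layer u' = layer u + 1),
      (gmat J P pol x0 u * pol u b) * √(P u b u' * r u b) * Vfun J P pol l u') +
    C * ((Fintype.card X : ℝ) ^ 2 * ∑ u, gmat J P pol x0 u * lbar pol r u) := by
  have hrr : ∀ u b, r u b ∈ Set.Icc (0:ℝ) 1 := fun u b => ⟨hr u b, hr1 u b⟩
  have key : ∀ u, ∑ u', gmat J P pol x0 u * tmat (ebd layer C P r) pol u u' * Vfun J P pol l u' ≤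
      C * (∑ b, ∑ u' ∈ Finset.univ.filter (fun u' => layer u' = layer u + 1),
        (gmat J P pol x0 u * pol u b) * √(P u b u' * r u b) * Vfun J P pol l u') +
      C * ((Fintype.card X : ℝ) ^ 2 * (gmat J P pol x0 u * lbar pol r u)) := by
    intro u
    have hL : ∑ u', gmat J P pol x0 u * tmat (ebd layer C P r) pol u u' * Vfun J P pol l u' =
      ∑ b, ∑ u' ∈ Finset.univ.filter (fun u' => layer u' = layer u + 1),
        (gmat J P pol x0 u * pol u b) * (C * (√(P u b u' * r u b) + r u b)) *
          Vfun J P pol l u' := by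
      unfold tmat
      simp only [Finset.sum_filter, Finset.mul_sum, Finset.sum_mul]
      rw [Finset.sum_comm]
      refine Finset.sum_congr rfl fun b _ => Finset.sum_congr rfl fun u' _ => ?_
      unfold ebd
      split_ifs <;> ring
    rw [hL]
    have hR : (Fintype.card X : ℝ) ^ 2 * (gmat J P pol x0 u * lbar pol r u) =
        ∑ b, (Fintype.card X : ℝ) ^ 2 * ((gmat J P pol x0 u * pol u b) * r u b) := by
      unfold lbar
      rw [Finset.mul_sum, Finset.mul_sum]
      refine Finset.sum_congr rfl fun b _ => by ring
    rw [hR, ← mul_add, ← Finset.sum_add_distrib, Finset.mul_sum]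
    refine Finset.sum_le_sum fun b _ => ?_
    have hw : 0 ≤ gmat J P pol x0 u * pol u b := mul_nonneg (gmat_nonneg hP hpol _ _) (hpol.1 _ _)
    have h3 : ∑ u' ∈ Finset.univ.filter (fun u' => layer u' = layer u + 1),
        (gmat J P pol x0 u * pol u b) * r u b * Vfun J P pol l u' ≤
        (Fintype.card X : ℝ) ^ 2 * ((gmat J P pol x0 u * pol u b) * r u b) := by
      have hw2 := mul_nonneg hw (hr u b)
      calc _ ≤ ∑ u' : X, (gmat J P pol x0 u * pol u b) * r u b * Vfun J P pol l u' :=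
            Finset.sum_le_sum_of_subset_of_nonneg (Finset.filter_subset _ _)
              fun u' _ _ => mul_nonneg hw2 (Vfun_nonneg hP hpol hl _)
        _ ≤ ∑ u' : X, (gmat J P pol x0 u * pol u b) * r u b * Fintype.card X :=
            Finset.sum_le_sum fun u' _ =>
              mul_le_mul_of_nonneg_left (Vfun_le_card hP hpol hle hl _) hw2
        _ = _ := by simp; ring
    have h4 : ∑ u' ∈ Finset.univ.filter (fun u' => layer u' = layer u + 1),
        (gmat J P pol x0 u * pol u b) * (C * (√(P u b u' * r u b) + r u b)) * Vfun J P pol l u' =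
        C * (∑ u' ∈ Finset.univ.filter (fun u' => layer u' = layer u + 1),
        (gmat J P pol x0 u * pol u b) * √(P u b u' * r u b) * Vfun J P pol l u' +
        ∑ u' ∈ Finset.univ.filter (fun u' => layer u' = layer u + 1),
        (gmat J P pol x0 u * pol u b) * r u b * Vfun J P pol l u') := by
      rw [← Finset.sum_add_distrib, Finset.mul_sum]
      refine Finset.sum_congr rfl fun u' _ => by ring
    rw [h4]
    exact mul_le_mul_of_nonneg_left (by linarith) hC
  refine (Finset.sum_le_sum fun u _ => key u).trans (le_of_eq ?_)
  rw [Finset.sum_add_distrib, ← Finset.mul_sum, ← Finset.mul_sum, ← Finset.mul_sum]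

end PartB


section PartB2

variable {X A : Type} [Fintype X] [DecidableEq X] [Fintype A] [DecidableEq A]

theorem layer_count {layer : X → ℕ} {J : ℕ} (hle : ∀ x, layer x ≤ J) :
    ∑ k ∈ Finset.range (J + 1),
      √(((Finset.univ.filter (fun u : X => layer u = k)).card : ℝ) *
        ((Finset.univ.filter (fun u : X => layer u = k + 1)).card : ℝ)) ≤ Fintype.card X := by
  set n : ℕ → ℝ := fun k => ((Finset.univ.filter (fun u : X => layer u = k)).card : ℝ) with hn
  have hn0 : ∀ k, 0 ≤ n k := fun k => by simp [hn]
  have h2 : ∑ k ∈ Finset.range (J + 2), n k = Fintype.card X := by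
    have := Finset.card_eq_sum_card_fiberwise (f := layer) (s := (Finset.univ : Finset X))
      (t := Finset.range (J + 2)) (fun x _ => by
        have := hle x
        simp; omega)
    rw [Finset.card_univ] at this
    rw [this]
    push_cast
    rfl
  have ha : ∑ k ∈ Finset.range (J + 1), n k ≤ Fintype.card X := by
    rw [← h2, Finset.sum_range_succ _ (J + 1)]
    linarith [hn0 (J + 1)]
  have hb : ∑ k ∈ Finset.range (J + 1), n (k + 1) ≤ Fintype.card X := by
    rw [← h2, Finset.sum_range_succ' _ (J + 1)]
    linarith [hn0 0]
  calc _ ≤ ∑ k ∈ Finset.range (J + 1), (n k + n (k + 1)) / 2 := by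
        refine Finset.sum_le_sum fun k _ => ?_
        rw [Real.sqrt_mul (hn0 k)]
        have a := Real.sq_sqrt (hn0 k)
        have b := Real.sq_sqrt (hn0 (k + 1))
        change √(n k) * √(n (k + 1)) ≤ _
        nlinarith [sq_nonneg (√(n k) - √(n (k + 1)))]
    _ ≤ _ := by
        rw [← Finset.sum_div, Finset.sum_add_distrib]
        linarith

theorem main_layer {layer : X → ℕ} {J : ℕ} {P : X → A → X → ℝ}
    (s : Finset ℕ) {pol l r : ℕ → X → A → ℝ}
    (hP : validTrans layer J P) (hpol : ∀ t, validPolicy (pol t)) (hle : ∀ x, layer x ≤ J)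
    (hl : ∀ t x a, l t x a ∈ Set.Icc (0:ℝ) 1) (x0 : X) (h0 : layer x0 = 0)
    (hr : ∀ t u b, 0 ≤ r t u b) {Λ : ℝ} (hΛ : 0 ≤ Λ)
    (hsum : ∀ u b, ∑ t ∈ s, gmat J P (pol t) x0 u * pol t u b * r t u b ≤ Λ) (k : ℕ) :
    ∑ t ∈ s, ∑ u ∈ Finset.univ.filter (fun u => layer u = k), ∑ b,
      ∑ u' ∈ Finset.univ.filter (fun u' => layer u' = k + 1),
      (gmat J P (pol t) x0 u * pol t u b) * √(P u b u' * r t u b) * Vfun J P (pol t) (l t) u' ≤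
    √((J + 1) * (∑ t ∈ s, lossOf layer P (pol t) x0 (l t))) *
      √(((Finset.univ.filter (fun u : X => layer u = k)).card : ℝ) *
        ((Finset.univ.filter (fun u : X => layer u = k + 1)).card : ℝ) *
        (Fintype.card A * Λ)) := by
  have hw : ∀ t u b, 0 ≤ gmat J P (pol t) x0 u * pol t u b := fun t u b =>
    mul_nonneg (gmat_nonneg hP (hpol t) _ _) ((hpol t).1 _ _)
  set f : ℕ × X × A × X → ℝ := fun p =>
    √((gmat J P (pol p.1) x0 p.2.1 * pol p.1 p.2.1 p.2.2.1) * P p.2.1 p.2.2.1 p.2.2.2) *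
      Vfun J P (pol p.1) (l p.1) p.2.2.2 with hf
  set g : ℕ × X × A × X → ℝ := fun p =>
    √((gmat J P (pol p.1) x0 p.2.1 * pol p.1 p.2.1 p.2.2.1) * r p.1 p.2.1 p.2.2.1) with hg
  set S := s ×ˢ ((Finset.univ.filter (fun u => layer u = k)) ×ˢ ((Finset.univ : Finset A) ×ˢ
    (Finset.univ.filter (fun u' => layer u' = k + 1)))) with hS
  have h1 : ∑ t ∈ s, ∑ u ∈ Finset.univ.filter (fun u => layer u = k), ∑ b,
      ∑ u' ∈ Finset.univ.filter (fun u' => layer u' = k + 1),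
      (gmat J P (pol t) x0 u * pol t u b) * √(P u b u' * r t u b) * Vfun J P (pol t) (l t) u' =
      ∑ p ∈ S, f p * g p := by
    rw [hS]
    simp only [Finset.sum_product]
    refine Finset.sum_congr rfl fun t _ => Finset.sum_congr rfl fun u _ =>
      Finset.sum_congr rfl fun b _ => Finset.sum_congr rfl fun u' _ => ?_
    simp only [hf, hg]
    rw [Real.sqrt_mul (hw t u b), Real.sqrt_mul (hw t u b), Real.sqrt_mul (hP.1 u b u')]
    have := Real.mul_self_sqrt (hw t u b)
    calc _ = (√(gmat J P (pol t) x0 u * pol t u b) * √(gmat J P (pol t) x0 u * pol t u b)) *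
          (√(P u b u') * √(r t u b)) * Vfun J P (pol t) (l t) u' := by rw [this]
      _ = _ := by ring
  rw [h1]
  refine (Real.sum_mul_le_sqrt_mul_sqrt S f g).trans ?_
  refine mul_le_mul (Real.sqrt_le_sqrt ?_) (Real.sqrt_le_sqrt ?_) (Real.sqrt_nonneg _)
    (Real.sqrt_nonneg _)
  · rw [hS]
    simp only [Finset.sum_product]
    rw [Finset.mul_sum]
    refine Finset.sum_le_sum fun t _ => ?_
    have hV : ∀ u, 0 ≤ Vfun J P (pol t) (l t) u := Vfun_nonneg hP (hpol t) (hl t)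
    calc _ ≤ ∑ u ∈ Finset.univ.filter (fun u => layer u = k), ∑ b,
            ∑ u' : X, (J + 1 : ℝ) *
            ((gmat J P (pol t) x0 u * pol t u b) * P u b u' * Vfun J P (pol t) (l t) u') := by
          refine Finset.sum_le_sum fun u _ => Finset.sum_le_sum fun b _ => ?_
          have hnn : ∀ u', 0 ≤ (gmat J P (pol t) x0 u * pol t u b) * P u b u' :=
            fun u' => mul_nonneg (hw t u b) (hP.1 _ _ _)
          refine (Finset.sum_le_sum fun u' _ => ?_).trans
            (Finset.sum_le_sum_of_subset_of_nonneg (Finset.filter_subset _ _)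
              fun u' _ _ => mul_nonneg (by positivity) (mul_nonneg (hnn u') (hV u')))
          simp only [hf]
          rw [mul_pow, Real.sq_sqrt (hnn u')]
          have hj := Vfun_le_J hP (hpol t) hle (hl t) u'
          nlinarith [mul_le_mul_of_nonneg_left hj (mul_nonneg (hnn u') (hV u'))]
      _ = (J + 1 : ℝ) * ∑ u ∈ Finset.univ.filter (fun u => layer u = k),
            gmat J P (pol t) x0 u * ∑ x, (tmat P (pol t) * gmat J P (pol t)) u x *
              lbar (pol t) (l t) x := by
          rw [Finset.mul_sum]
          refine Finset.sum_congr rfl fun u _ => ?_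
          simp only [Matrix.mul_apply, tmat, Vfun]
          simp only [Finset.mul_sum, Finset.sum_mul]
          rw [Finset.sum_comm]
          rw [Finset.sum_congr rfl fun u' _ => Finset.sum_comm]
          rw [Finset.sum_comm]
          refine Finset.sum_congr rfl fun u' _ => Finset.sum_congr rfl fun x _ =>
            Finset.sum_congr rfl fun b _ => ?_
          ring
      _ ≤ (J + 1 : ℝ) * ∑ u ∈ Finset.univ.filter (fun u => layer u = k),
            gmat J P (pol t) x0 u * ∑ x, gmat J P (pol t) u x *
              lbar (pol t) (l t) x := by
          refine mul_le_mul_of_nonneg_left ?_ (by positivity)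
          refine Finset.sum_le_sum fun u _ => ?_
          refine mul_le_mul_of_nonneg_left ?_ (gmat_nonneg hP (hpol t) _ _)
          refine Finset.sum_le_sum fun x _ => ?_
          exact mul_le_mul_of_nonneg_right (tmat_mul_gmat_le hP hle u x)
            (lbar_nonneg (hpol t) (hl t) x)
      _ = (J + 1 : ℝ) * ∑ x, (∑ u ∈ Finset.univ.filter (fun u => layer u = k),
            gmat J P (pol t) x0 u * gmat J P (pol t) u x) * lbar (pol t) (l t) x := by
          congr 1
          simp only [Finset.mul_sum, Finset.sum_mul]
          rw [Finset.sum_comm]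
          refine Finset.sum_congr rfl fun x _ => Finset.sum_congr rfl fun u _ => ?_
          ring
      _ ≤ _ := by
          refine mul_le_mul_of_nonneg_left ?_ (by positivity)
          rw [lossOf_eq hP hle x0 h0]
          refine Finset.sum_le_sum fun x _ => ?_
          exact mul_le_mul_of_nonneg_right (gmat_layer_sum hP (hpol t) hle x0 h0 k x)
            (lbar_nonneg (hpol t) (hl t) x)
  · rw [hS]
    simp only [Finset.sum_product]
    rw [Finset.sum_comm]
    rw [Finset.sum_congr rfl fun u _ => Finset.sum_comm]
    rw [Finset.sum_congr rfl fun u _ => Finset.sum_congr rfl fun b _ => Finset.sum_comm]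
    refine (Finset.sum_le_sum (g := fun _ => ∑ _b : A,
      ∑ _u' ∈ Finset.univ.filter (fun u' : X => layer u' = k + 1), Λ)
      fun u _ => Finset.sum_le_sum fun b _ => Finset.sum_le_sum fun u' _ => ?_).trans
      (le_of_eq ?_)
    · refine le_trans (le_of_eq ?_) (hsum u b)
      refine Finset.sum_congr rfl fun t _ => ?_
      simp only [hg]
      rw [Real.sq_sqrt (mul_nonneg (hw t u b) (hr t u b))]
    · simp only [Finset.sum_const, nsmul_eq_mul, Finset.card_univ]
      ring

theorem main_term {layer : X → ℕ} {J : ℕ} {P : X → A → X → ℝ}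
    (s : Finset ℕ) {pol l r : ℕ → X → A → ℝ}
    (hP : validTrans layer J P) (hpol : ∀ t, validPolicy (pol t)) (hle : ∀ x, layer x ≤ J)
    (hl : ∀ t x a, l t x a ∈ Set.Icc (0:ℝ) 1) (x0 : X) (h0 : layer x0 = 0)
    (hr : ∀ t u b, 0 ≤ r t u b) {Λ : ℝ} (hΛ : 0 ≤ Λ)
    (hsum : ∀ u b, ∑ t ∈ s, gmat J P (pol t) x0 u * pol t u b * r t u b ≤ Λ) :
    ∑ t ∈ s, ∑ u, ∑ b, ∑ u' ∈ Finset.univ.filter (fun u' => layer u' = layer u + 1),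
      (gmat J P (pol t) x0 u * pol t u b) * √(P u b u' * r t u b) * Vfun J P (pol t) (l t) u' ≤
    Fintype.card X * √((J + 1) * (∑ t ∈ s, lossOf layer P (pol t) x0 (l t)) *
      (Fintype.card A * Λ)) := by
  have hL : 0 ≤ ∑ t ∈ s, lossOf layer P (pol t) x0 (l t) :=
    Finset.sum_nonneg fun t _ => by
      rw [lossOf_eq hP hle x0 h0]; exact Vfun_nonneg hP (hpol t) (hl t) _
  calc _ = ∑ k ∈ Finset.range (J + 1), ∑ t ∈ s,
        ∑ u ∈ Finset.univ.filter (fun u => layer u = k), ∑ b,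
        ∑ u' ∈ Finset.univ.filter (fun u' => layer u' = k + 1),
        (gmat J P (pol t) x0 u * pol t u b) * √(P u b u' * r t u b) *
          Vfun J P (pol t) (l t) u' := by
        rw [Finset.sum_comm (s := Finset.range (J + 1))]
        refine Finset.sum_congr rfl fun t _ => ?_
        rw [← Finset.sum_fiberwise_of_maps_to (s := (Finset.univ : Finset X))
          (t := Finset.range (J + 1)) (g := layer) (fun x _ => by
            have := hle x
            simp; omega)]
        refine Finset.sum_congr rfl fun k _ => Finset.sum_congr rfl fun u hu => ?_
        rw [(Finset.mem_filter.1 hu).2]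
    _ ≤ ∑ k ∈ Finset.range (J + 1), √((J + 1) * (∑ t ∈ s, lossOf layer P (pol t) x0 (l t)) *
          (Fintype.card A * Λ)) *
          √(((Finset.univ.filter (fun u : X => layer u = k)).card : ℝ) *
          ((Finset.univ.filter (fun u : X => layer u = k + 1)).card : ℝ)) := by
        refine Finset.sum_le_sum fun k _ => ?_
        refine (main_layer s hP hpol hle hl x0 h0 hr hΛ hsum k).trans (le_of_eq ?_)
        rw [Real.sqrt_mul (by positivity) (Fintype.card A * Λ),
          Real.sqrt_mul (by positivity) (Fintype.card A * Λ)]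
        ring
    _ ≤ _ := by
        rw [← Finset.mul_sum, mul_comm]
        exact mul_le_mul_of_nonneg_right (layer_count hle) (Real.sqrt_nonneg _)

theorem deterministic {layer : X → ℕ} {J : ℕ} {P : X → A → X → ℝ}
    (s : Finset ℕ) {pol l r : ℕ → X → A → ℝ} {Q : ℕ → X → X → A → X → ℝ}
    (hP : validTrans layer J P) (hpol : ∀ t, validPolicy (pol t)) (hle : ∀ x, layer x ≤ J)
    (hl : ∀ t x a, l t x a ∈ Set.Icc (0:ℝ) 1) (x0 : X) (h0 : layer x0 = 0)
    (hr : ∀ t u b, 0 ≤ r t u b) (hr1 : ∀ t u b, r t u b ≤ 1) {Λ C : ℝ} (hΛ : 0 ≤ Λ) (hC : 0 ≤ C)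
    (hsum : ∀ u b, ∑ t ∈ s, gmat J P (pol t) x0 u * pol t u b * r t u b ≤ Λ)
    (hQ : ∀ t ∈ s, ∀ x, validTrans layer J (Q t x))
    (he : ∀ t ∈ s, ∀ y x a x', |Q t y x a x' - P x a x'| ≤ ebd layer C P (r t) x a x') :
    ∑ t ∈ s, ∑ x, ∑ a, |occ layer (Q t x) (pol t) x0 x a - occ layer P (pol t) x0 x a| * l t x a ≤
    C * (Fintype.card X * √((J + 1) * (∑ t ∈ s, lossOf layer P (pol t) x0 (l t)) *
      (Fintype.card A * Λ))) +
    (C + 4 * C ^ 2) * ((Fintype.card X : ℝ) ^ 5 * Fintype.card A * Λ) := by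
  have hcard : (1:ℝ) ≤ Fintype.card X := by
    exact_mod_cast Fintype.card_pos_iff.2 ⟨x0⟩
  have hR : ∑ t ∈ s, ∑ u, gmat J P (pol t) x0 u * lbar (pol t) (r t) u ≤
      Fintype.card X * Fintype.card A * Λ := by
    rw [Finset.sum_comm]
    have : ∀ u, ∑ t ∈ s, gmat J P (pol t) x0 u * lbar (pol t) (r t) u ≤ Fintype.card A * Λ := by
      intro u
      unfold lbar
      simp only [Finset.mul_sum]
      rw [Finset.sum_comm]
      refine (Finset.sum_le_sum (g := fun _ => Λ) fun b _ => ?_).trans (by simp)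
      simp only [← mul_assoc]
      exact hsum u b
    refine (Finset.sum_le_sum fun u _ => this u).trans (by simp [mul_assoc])
  set R := ∑ t ∈ s, ∑ u, gmat J P (pol t) x0 u * lbar (pol t) (r t) u with hRdef
  set n : ℝ := (Fintype.card X : ℝ)
  have step : ∀ t ∈ s, ∑ x, ∑ a, |occ layer (Q t x) (pol t) x0 x a - occ layer P (pol t) x0 x a| *
      l t x a ≤ C * (∑ u, ∑ b, ∑ u' ∈ Finset.univ.filter (fun u' => layer u' = layer u + 1),
      (gmat J P (pol t) x0 u * pol t u b) * √(P u b u' * r t u b) * Vfun J P (pol t) (l t) u') +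
      (C * n ^ 2 + n * (4 * C ^ 2 * n ^ 3)) *
        ∑ u, gmat J P (pol t) x0 u * lbar (pol t) (r t) u := by
    intro t ht
    have h1 := per_episode hP (hQ t ht) (hpol t) hle (hl t) _ (he t ht) x0 h0
    have h2 := first_order hP (hpol t) hle (hl t) x0 hC (hr t) (hr1 t)
    have h3 := second_order hP (hpol t) hle x0 h0 hC (hr t) (hr1 t)
    refine h1.trans ?_
    simp only [mul_add, Finset.sum_add_distrib]
    have h4 : ∑ u, ∑ u', gmat J P (pol t) x0 u * tmat (ebd layer C P (r t)) (pol t) u u' *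
      (n * ∑ v, ∑ v', gmat J P (pol t) u' v * tmat (ebd layer C P (r t)) (pol t) v v') =
      n * ∑ u, ∑ u', gmat J P (pol t) x0 u * tmat (ebd layer C P (r t)) (pol t) u u' *
      ∑ v, ∑ v', gmat J P (pol t) u' v * tmat (ebd layer C P (r t)) (pol t) v v' := by
      rw [Finset.mul_sum]
      refine Finset.sum_congr rfl fun u _ => ?_
      rw [Finset.mul_sum]
      refine Finset.sum_congr rfl fun u' _ => ?_
      ring
    rw [h4]
    have h5 := mul_le_mul_of_nonneg_left h3 (show 0 ≤ n by positivity)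
    linarith
  refine (Finset.sum_le_sum step).trans ?_
  rw [Finset.sum_add_distrib, ← Finset.mul_sum, ← Finset.mul_sum]
  refine add_le_add ?_ ?_
  · exact mul_le_mul_of_nonneg_left (main_term s hP hpol hle hl x0 h0 hr hΛ hsum) hC
  · have hn : n ^ 2 ≤ n ^ 4 := pow_le_pow_right₀ hcard (by norm_num)
    have hcc : C * n ^ 2 + n * (4 * C ^ 2 * n ^ 3) ≤ (C + 4 * C ^ 2) * n ^ 4 := by
      nlinarith [mul_le_mul_of_nonneg_left hn hC]
    calc _ ≤ (C * n ^ 2 + n * (4 * C ^ 2 * n ^ 3)) * (n * Fintype.card A * Λ) :=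
          mul_le_mul_of_nonneg_left hR (by positivity)
      _ ≤ ((C + 4 * C ^ 2) * n ^ 4) * (n * Fintype.card A * Λ) :=
          mul_le_mul_of_nonneg_right hcc (by positivity)
      _ = _ := by ring

end PartB2


section PartC

noncomputable def lamf (p : ℝ) (n : ℕ) (L : ℝ) : ℝ := if p * n ≤ L then 1 else √(L / (p * n))

theorem lamf_pos {p : ℝ} {n : ℕ} {L : ℝ} (hL : 0 < L) : 0 < lamf p n L := by
  unfold lamf
  split_ifs with h
  · norm_num
  · push Not at h
    have : 0 < p * n := hL.trans h
    positivity

theorem lamf_le_one {p : ℝ} {n : ℕ} {L : ℝ} (hL : 0 < L) : lamf p n L ≤ 1 := by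
  unfold lamf
  split_ifs with h
  · exact le_rfl
  · push Not at h
    rw [Real.sqrt_le_one, div_le_one (hL.trans h)]
    exact h.le

theorem dev_bound {p : ℝ} {n : ℕ} {L d : ℝ} (hp : 0 ≤ p) (hL : 0 < L)
    (h1 : lamf p n L * d - (lamf p n L) ^ 2 * (p * n) ≤ L)
    (h2 : (-lamf p n L) * d - (-lamf p n L) ^ 2 * (p * n) ≤ L) :
    |d| ≤ 2 * √(p * n * L) + 2 * L := by
  have hpos := lamf_pos (p := p) (n := n) hL
  have hpn : 0 ≤ p * n := by positivity
  have key : lamf p n L * |d| ≤ (lamf p n L) ^ 2 * (p * n) + L := by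
    rcases abs_cases d with h | h <;> rw [h.1] <;> nlinarith
  unfold lamf at key hpos
  split_ifs at key hpos with h
  · have := Real.sqrt_nonneg (p * n * L)
    nlinarith
  · push Not at h
    have hpn' : 0 < p * n := hL.trans h
    rw [Real.sq_sqrt (by positivity), div_mul_cancel₀ _ hpn'.ne'] at key
    have h3 : |d| ≤ 2 * L / √(L / (p * n)) := by
      rw [le_div_iff₀ hpos]; linarith
    have h4 : 2 * L / √(L / (p * n)) = 2 * √(p * n * L) := by
      rw [div_eq_iff hpos.ne', mul_assoc, ← Real.sqrt_mul (by positivity)]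
      rw [show p * n * L * (L / (p * n)) = L ^ 2 by
        have := div_mul_cancel₀ L hpn'.ne'
        calc p * n * L * (L / (p * n)) = L * (L / (p * n) * (p * n)) := by ring
          _ = L ^ 2 := by rw [this]; ring, Real.sqrt_sq hL.le]
    linarith

theorem conf_numeric {p q cnt N L : ℝ} (hp : 0 ≤ p) (hL : 1 ≤ L) (hN : L ≤ N) (hcnt : 0 ≤ cnt)
    (h1 : |cnt - p * N| ≤ 2 * √(p * N * (4 * L)) + 2 * (4 * L))
    (h2 : |q - cnt / max 1 N| ≤ 4 * √(cnt / max 1 N * L / max 1 (N - 1)) +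
      28 * L / (3 * max 1 (N - 1))) :
    |q - p| ≤ 47 * (√(p * (L / N)) + L / N) := by
  have hN1 : 1 ≤ N := hL.trans hN
  have hN0 : 0 < N := by linarith
  rw [max_eq_right hN1] at h2
  have hm : N / 2 ≤ max 1 (N - 1) := by
    rcases le_total 2 N with h | h
    · exact (by linarith : N / 2 ≤ N - 1).trans (le_max_right _ _)
    · exact (by linarith : N / 2 ≤ 1).trans (le_max_left _ _)
  set m := max 1 (N - 1)
  have hm0 : 0 < m := by linarith
  set ρ := L / N with hρ
  have hρ0 : 0 < ρ := by positivity
  have hLm : L / m ≤ 2 * ρ := by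
    rw [hρ, div_le_iff₀ hm0]
    have : L / N * N = L := by field_simp
    nlinarith [mul_le_mul_of_nonneg_left hm hρ0.le]
  set s := √(p * ρ) with hs
  have hs0 : 0 ≤ s := Real.sqrt_nonneg _
  have hs2 : s ^ 2 = p * ρ := Real.sq_sqrt (by positivity)
  set e := cnt / N with he
  have he0 : 0 ≤ e := by positivity
  have h1' : |e - p| ≤ 4 * s + 8 * ρ := by
    have e1 : e - p = (cnt - p * N) / N := by rw [he]; field_simp
    have e2 : √(p * N * (4 * L)) = 2 * s * N := by
      rw [show p * N * (4 * L) = (2 * s * N) ^ 2 by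
        rw [mul_pow, mul_pow, hs2, hρ]; field_simp; ring]
      exact Real.sqrt_sq (by positivity)
    rw [e1, abs_div, abs_of_pos hN0, div_le_iff₀ hN0]
    rw [e2] at h1
    have : ρ * N = L := by rw [hρ]; field_simp
    nlinarith
  have hle : e ≤ 2 * p + 12 * ρ := by
    have := (abs_le.1 h1').2
    have h4 : 4 * s ≤ p + 4 * ρ := by
      refine (pow_le_pow_iff_left₀ (by positivity) (by positivity) two_ne_zero).1 ?_
      nlinarith [sq_nonneg (p - 4 * ρ)]
    linarith
  have hsq : √(e * L / m) ≤ 2 * s + 5 * ρ := by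
    rw [Real.sqrt_le_left (by positivity)]
    calc e * L / m = e * (L / m) := by ring
      _ ≤ (2 * p + 12 * ρ) * (2 * ρ) := mul_le_mul hle hLm (by positivity) (by positivity)
      _ ≤ _ := by nlinarith [mul_nonneg hs0 hρ0.le]
  have h28 : 28 * L / (3 * m) ≤ 19 * ρ := by
    rw [show 28 * L / (3 * m) = 28 / 3 * (L / m) by field_simp]
    linarith
  have := abs_sub_le q e p
  linarith

theorem k2_sum (T : ℕ) (w : ℕ → ℝ) (N : ℕ → ℝ) (L : ℝ) (hL : 1 ≤ L)
    (hw0 : ∀ t, 0 ≤ w t) (hw1 : ∀ t, w t ≤ 1)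
    (hN : ∀ t ∈ Finset.Icc 1 T, ∑ τ ∈ Finset.Icc 1 (t - 1), w τ ≤ 4 * N t + 8 * L) :
    ∑ t ∈ Finset.Icc 1 T, w t * (L / max L (N t)) ≤ 14 * L * Real.log (1 + T) := by
  have hW0 : ∀ t, 0 ≤ ∑ τ ∈ Finset.Icc 1 t, w τ := fun t => Finset.sum_nonneg fun τ _ => hw0 τ
  have main : ∀ t ≤ T, ∑ τ ∈ Finset.Icc 1 t, w τ * (L / max L (N τ)) ≤
      14 * L * Real.log (1 + ∑ τ ∈ Finset.Icc 1 t, w τ) := by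
    intro t
    induction t with
    | zero => simp
    | succ t ih =>
      intro ht
      have ih' := ih (by omega)
      rw [Finset.sum_Icc_succ_top (by omega), Finset.sum_Icc_succ_top (by omega)]
      set W := ∑ τ ∈ Finset.Icc 1 t, w τ with hWd
      have hWn : 0 ≤ W := hW0 t
      have h1 := hN (t + 1) (by simp; omega)
      simp only [Nat.add_sub_cancel] at h1
      have hmL := le_max_left L (N (t + 1))
      have hmN := le_max_right L (N (t + 1))
      set m := max L (N (t + 1))
      have hwt := hw0 (t + 1)
      have hwt1 := hw1 (t + 1)
      set v := w (t + 1)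
      have hpos : 0 < 1 + (W + v) := by linarith
      have h2 : L / m ≤ 14 * L / (1 + (W + v)) := by
        rw [div_le_div_iff₀ (by linarith) hpos]
        nlinarith
      have h3 : v / (1 + (W + v)) ≤ Real.log (1 + (W + v)) - Real.log (1 + W) := by
        rw [← Real.log_div hpos.ne' (by linarith)]
        refine le_trans (le_of_eq ?_) (Real.one_sub_inv_le_log_of_pos (by positivity))
        rw [inv_div]
        field_simp
        ring
      have h4 : v * (L / m) ≤ 14 * L * (v / (1 + (W + v))) := by
        calc _ ≤ v * (14 * L / (1 + (W + v))) := mul_le_mul_of_nonneg_left h2 hwt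
          _ = _ := by ring
      have h5 := mul_le_mul_of_nonneg_left h3 (show 0 ≤ 14 * L by linarith)
      linarith
  refine (main T le_rfl).trans ?_
  refine mul_le_mul_of_nonneg_left ?_ (by linarith)
  refine Real.log_le_log (by linarith [hW0 T]) ?_
  have : ∑ τ ∈ Finset.Icc 1 T, w τ ≤ T := by
    refine (Finset.sum_le_sum fun τ _ => hw1 τ).trans (by simp)
  linarith

variable {X A Ω : Type} [Fintype X] [DecidableEq X] [Fintype A] [DecidableEq A]

theorem visits_succ (layer : X → ℕ) (st : ℕ → Ω → ℕ → X) (ac : ℕ → Ω → ℕ → A)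
    (t : ℕ) (x : X) (a : A) (ω : Ω) :
    visits layer st ac (t + 1) x a ω = visits layer st ac t x a ω +
      if st (t + 1) ω (layer x) = x ∧ ac (t + 1) ω (layer x) = a then 1 else 0 := by
  unfold visits
  rw [Finset.sum_Icc_succ_top (by omega)]

theorem epoch_bound {J T : ℕ} (layer : X → ℕ) (st : ℕ → Ω → ℕ → X) (ac : ℕ → Ω → ℕ → A)
    (Bt : ℕ → Ω → ℕ) (ω : Ω) (hB1 : Bt 1 ω = 0)
    (hBrec : ∀ t ∈ Finset.Icc 1 T,
        ((∃ k < J, max 1 (2 * visits layer st ac (Bt t ω) (st t ω k) (ac t ω k) ω)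
            ≤ visits layer st ac t (st t ω k) (ac t ω k) ω) →
          Bt (t + 1) ω = t) ∧
        (¬ (∃ k < J, max 1 (2 * visits layer st ac (Bt t ω) (st t ω k) (ac t ω k) ω)
            ≤ visits layer st ac t (st t ω k) (ac t ω k) ω) →
          Bt (t + 1) ω = Bt t ω)) (t : ℕ) (ht : t ≤ T) :
    Bt (t + 1) ω ≤ t ∧ ∀ x a, layer x < J →
      visits layer st ac t x a ω ≤ 2 * visits layer st ac (Bt (t + 1) ω) x a ω := by
  induction t with
  | zero =>
    refine ⟨by simp [hB1], fun x a _ => ?_⟩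
    simp [visits]
  | succ t ih =>
    obtain ⟨ih1, ih2⟩ := ih (by omega)
    have hr := hBrec (t + 1) (by simp; omega)
    by_cases hc : ∃ k < J, max 1 (2 * visits layer st ac (Bt (t + 1) ω) (st (t + 1) ω k)
        (ac (t + 1) ω k) ω) ≤ visits layer st ac (t + 1) (st (t + 1) ω k) (ac (t + 1) ω k) ω
    · rw [hr.1 hc]
      exact ⟨le_rfl, fun x a _ => by omega⟩
    · rw [hr.2 hc]
      refine ⟨by omega, fun x a hx => ?_⟩
      rw [visits_succ]
      split_ifs with hv
      · push Not at hc
        have := hc (layer x) hx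
        rw [hv.1, hv.2, visits_succ, if_pos hv] at this
        omega
      · exact ih2 x a hx

end PartC


section PartD

variable {Ω : Type} {m0 : MeasurableSpace Ω}

theorem prod_integral_le_one (μ : Measure Ω) [IsProbabilityMeasure μ]
    (F : ℕ → MeasurableSpace Ω) (hFmono : Monotone F) (hFle : ∀ t, F t ≤ m0)
    (T : ℕ) (Y : ℕ → Ω → ℝ) (K : ℝ)
    (hY : ∀ t ∈ Finset.Icc 1 T, StronglyMeasurable[F (t + 1)] (Y t))
    (hY0 : ∀ t ω, 0 ≤ Y t ω) (hYK : ∀ t ω, Y t ω ≤ K)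
    (hc : ∀ t ∈ Finset.Icc 1 T, μ[Y t | F t] ≤ᵐ[μ] fun _ => (1:ℝ)) (t : ℕ) (ht : t ≤ T) :
    StronglyMeasurable[F (t + 1)] (fun ω => ∏ τ ∈ Finset.Icc 1 t, Y τ ω) ∧
    Integrable (fun ω => ∏ τ ∈ Finset.Icc 1 t, Y τ ω) μ ∧
    ∫ ω, ∏ τ ∈ Finset.Icc 1 t, Y τ ω ∂μ ≤ 1 := by
  induction t with
  | zero => simp [stronglyMeasurable_const]
  | succ t ih =>
    obtain ⟨ih1, ih2, ih3⟩ := ih (by omega)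
    have hmem : t + 1 ∈ Finset.Icc 1 T := by simp; omega
    have hYm := hY (t + 1) hmem
    have hYint : Integrable (Y (t + 1)) μ := by
      refine Integrable.of_bound (hYm.mono (hFle _)).aestronglyMeasurable K ?_
      refine Filter.Eventually.of_forall fun ω => ?_
      rw [Real.norm_eq_abs, abs_of_nonneg (hY0 _ _)]
      exact hYK _ _
    have heq : (fun ω => ∏ τ ∈ Finset.Icc 1 (t + 1), Y τ ω) =
        (fun ω => ∏ τ ∈ Finset.Icc 1 t, Y τ ω) * Y (t + 1) := by
      funext ω
      rw [Finset.prod_Icc_succ_top (by omega)]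
      rfl
    rw [heq]
    have hint : Integrable ((fun ω => ∏ τ ∈ Finset.Icc 1 t, Y τ ω) * Y (t + 1)) μ := by
      refine Integrable.mul_bdd (c := K) ih2 (hYm.mono (hFle _)).aestronglyMeasurable ?_
      refine Filter.Eventually.of_forall fun ω => ?_
      rw [Real.norm_eq_abs, abs_of_nonneg (hY0 _ _)]
      exact hYK _ _
    refine ⟨(ih1.mono (hFmono (by omega))).mul hYm, hint, ?_⟩
    rw [← integral_condExp (hFle (t + 1))]
    refine le_trans (integral_mono_ae integrable_condExp ih2 ?_) ih3
    filter_upwards [condExp_mul_of_stronglyMeasurable_left ih1 hint hYint, hc _ hmem] with ω h2 h3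
    rw [h2]
    exact mul_le_of_le_one_right (Finset.prod_nonneg fun τ _ => hY0 _ _) h3

theorem exp_markov (μ : Measure Ω) [IsProbabilityMeasure μ]
    (F : ℕ → MeasurableSpace Ω) (hFmono : Monotone F) (hFle : ∀ t, F t ≤ m0)
    (T : ℕ) (Z : ℕ → Ω → ℝ) (K : ℝ)
    (hZ : ∀ t ∈ Finset.Icc 1 T, StronglyMeasurable[F (t + 1)] (fun ω => Real.exp (Z t ω)))
    (hZK : ∀ t ω, Z t ω ≤ K)
    (hc : ∀ t ∈ Finset.Icc 1 T, μ[fun ω => Real.exp (Z t ω) | F t] ≤ᵐ[μ] fun _ => (1:ℝ))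
    (t : ℕ) (ht : t ≤ T) (L : ℝ) :
    μ {ω | L < ∑ τ ∈ Finset.Icc 1 t, Z τ ω} ≤ ENNReal.ofReal (Real.exp (-L)) := by
  obtain ⟨-, h2, h3⟩ := prod_integral_le_one μ F hFmono hFle T (fun t ω => Real.exp (Z t ω))
    (Real.exp K) hZ (fun _ _ => (Real.exp_pos _).le) (fun t ω => Real.exp_le_exp.2 (hZK t ω)) hc t ht
  have h4 := mul_meas_ge_le_integral_of_nonneg (μ := μ)
    (f := fun ω => ∏ τ ∈ Finset.Icc 1 t, Real.exp (Z τ ω))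
    (Filter.Eventually.of_forall fun ω => Finset.prod_nonneg fun _ _ => (Real.exp_pos _).le)
    h2 (Real.exp L)
  have h5 : μ.real {ω | Real.exp L ≤ ∏ τ ∈ Finset.Icc 1 t, Real.exp (Z τ ω)} ≤ Real.exp (-L) := by
    rw [Real.exp_neg, ← one_div, le_div_iff₀ (Real.exp_pos L), mul_comm]
    exact h4.trans h3
  refine (measure_mono ?_).trans ((ENNReal.le_ofReal_iff_toReal_le (measure_ne_top _ _)
    (Real.exp_pos _).le).2 h5)
  intro ω hω
  simp only [Set.mem_ofPred_eq] at hω ⊢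
  rw [← Real.exp_sum]
  exact Real.exp_le_exp.2 hω.le

variable {X A : Type} [Fintype X] [DecidableEq X] [Fintype A] [DecidableEq A]

def cyl (S : Ω → ℕ → X) (B : Ω → ℕ → A) (j n : ℕ) (xs : ℕ → X) (as_ : ℕ → A) : Set Ω :=
  {ω | (∀ k, j ≤ k → k ≤ n → S ω k = xs k) ∧ ∀ k, j ≤ k → k < n → B ω k = as_ k}

theorem cyl_meas {S : Ω → ℕ → X} {B : Ω → ℕ → A}
    (hS : ∀ k x, MeasurableSet {ω | S ω k = x}) (hB : ∀ k a, MeasurableSet {ω | B ω k = a})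
    (j n : ℕ) (xs : ℕ → X) (as_ : ℕ → A) : MeasurableSet (cyl S B j n xs as_) := by
  unfold cyl
  have : {ω | (∀ k, j ≤ k → k ≤ n → S ω k = xs k) ∧ ∀ k, j ≤ k → k < n → B ω k = as_ k} =
    (⋂ k, ⋂ (_ : j ≤ k), ⋂ (_ : k ≤ n), {ω | S ω k = xs k}) ∩
    (⋂ k, ⋂ (_ : j ≤ k), ⋂ (_ : k < n), {ω | B ω k = as_ k}) := by
    ext ω; simp
  rw [this]
  refine MeasurableSet.inter ?_ ?_
  · exact MeasurableSet.iInter fun k => MeasurableSet.iInter fun _ => MeasurableSet.iInter fun _ =>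
      hS _ _
  · exact MeasurableSet.iInter fun k => MeasurableSet.iInter fun _ => MeasurableSet.iInter fun _ =>
      hB _ _

theorem sum_ind (s : Set Ω) (G : X → A → Set Ω) (f : Ω → X) (g : Ω → A)
    (h : ∀ x a ω, ω ∈ G x a ↔ ω ∈ s ∧ f ω = x ∧ g ω = a) :
    Set.indicator s (fun _ => (1:ℝ)) =
      ∑ x, ∑ a, Set.indicator (G x a) (fun _ => (1:ℝ)) := by
  classical
  funext ω
  simp only [Finset.sum_apply, Set.indicator_apply, h]
  by_cases hs : ω ∈ s
  · simp only [hs, true_and, if_true]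
    rw [Finset.sum_eq_single (f ω), Finset.sum_eq_single (g ω)]
    · simp
    · intro a _ ha; simp [ha.symm]
    · simp
    · intro x _ hx; simp [hx.symm]
    · simp
  · simp [hs]

theorem condExp_sum_ind (μ : Measure Ω) [IsProbabilityMeasure μ] (m : MeasurableSpace Ω)
    (s : Set Ω) (G : X → A → Set Ω) (f : Ω → X) (g : Ω → A)
    (hG : ∀ x a, MeasurableSet[m0] (G x a))
    (h : ∀ x a ω, ω ∈ G x a ↔ ω ∈ s ∧ f ω = x ∧ g ω = a) (q : X → A → Ω → ℝ)
    (hq : ∀ x a, μ[Set.indicator (G x a) (fun _ => (1:ℝ)) | m] =ᵐ[μ] q x a) :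
    μ[Set.indicator s (fun _ => (1:ℝ)) | m] =ᵐ[μ] fun ω => ∑ x, ∑ a, q x a ω := by
  rw [sum_ind s G f g h]
  have hint : ∀ x a, Integrable (Set.indicator (G x a) (fun _ => (1:ℝ))) μ := fun x a =>
    (integrable_const _).indicator (hG x a)
  have h1 := condExp_finsetSum (μ := μ) (s := (Finset.univ : Finset X))
    (f := fun x => ∑ a, Set.indicator (G x a) (fun _ => (1:ℝ)))
    (fun x _ => integrable_finsetSum' _ fun a _ => hint x a) m
  have h2 : ∀ x, μ[∑ a, Set.indicator (G x a) (fun _ => (1:ℝ)) | m] =ᵐ[μ]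
      ∑ a, μ[Set.indicator (G x a) (fun _ => (1:ℝ)) | m] := fun x =>
    condExp_finsetSum (fun a _ => hint x a) m
  have h2' := ae_all_iff.2 h2
  have h3 : ∀ᵐ ω ∂μ, ∀ x a, (μ[Set.indicator (G x a) (fun _ => (1:ℝ)) | m]) ω = q x a ω :=
    ae_all_iff.2 fun x => ae_all_iff.2 fun a => hq x a
  filter_upwards [h1, h2', h3] with ω e1 e2 e3
  rw [e1, Finset.sum_apply]
  refine Finset.sum_congr rfl fun x _ => ?_
  rw [e2 x, Finset.sum_apply]
  exact Finset.sum_congr rfl fun a _ => e3 x a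

section law

variable (μ : Measure Ω) [IsProbabilityMeasure μ] (m : MeasurableSpace Ω)
  {layer : X → ℕ} {J : ℕ} {P : X → A → X → ℝ} {pol : Ω → X → A → ℝ} {x0 : X}
  {S : Ω → ℕ → X} {B : Ω → ℕ → A}

def LawS (P : X → A → X → ℝ) (pol : Ω → X → A → ℝ) (x0 : X) (S : Ω → ℕ → X) (B : Ω → ℕ → A)
    (j n : ℕ) : Prop :=
  ∀ (xs : ℕ → X) (as_ : ℕ → A), μ[Set.indicator (cyl S B j n xs as_) (fun _ => (1:ℝ)) | m] =ᵐ[μ]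
    fun ω => reach P (pol ω) x0 j (xs j) *
      ∏ k ∈ Finset.Ico j n, (pol ω (xs k) (as_ k) * P (xs k) (as_ k) (xs (k + 1)))

theorem law_right (hP : validTrans layer J P) (hpol : ∀ ω, validPolicy (pol ω))
    (h0 : layer x0 = 0)
    (hS : ∀ k x, MeasurableSet[m0] {ω | S ω k = x}) (hB : ∀ k a, MeasurableSet[m0] {ω | B ω k = a})
    (n : ℕ) (hn : n < J) (h : LawS μ m P pol x0 S B 0 (n + 1)) : LawS μ m P pol x0 S B 0 n := by
  intro xs as_
  have := condExp_sum_ind μ m (cyl S B 0 n xs as_)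
    (fun x a => cyl S B 0 (n + 1) (Function.update xs (n + 1) x) (Function.update as_ n a))
    (fun ω => S ω (n + 1)) (fun ω => B ω n) (fun x a => cyl_meas hS hB _ _ _ _) ?_ _
    (fun x a => h _ _)
  · refine this.trans (Filter.Eventually.of_forall fun ω => ?_)
    have e : ∀ x a, reach P (pol ω) x0 0 (Function.update xs (n + 1) x 0) *
        ∏ k ∈ Finset.Ico 0 (n + 1), (pol ω (Function.update xs (n + 1) x k)
          (Function.update as_ n a k) * P (Function.update xs (n + 1) x k)
          (Function.update as_ n a k) (Function.update xs (n + 1) x (k + 1))) =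
        (reach P (pol ω) x0 0 (xs 0) *
        ∏ k ∈ Finset.Ico 0 n, (pol ω (xs k) (as_ k) * P (xs k) (as_ k) (xs (k + 1)))) *
        (pol ω (xs n) a * P (xs n) a x) := by
      intro x a
      rw [Finset.prod_Ico_succ_top (by omega), ← mul_assoc]
      congr 1
      · congr 1
        refine Finset.prod_congr rfl fun k hk => ?_
        have hk' : k < n := (Finset.mem_Ico.1 hk).2
        rw [Function.update_of_ne (by omega), Function.update_of_ne (by omega),
          Function.update_of_ne (by omega)]
      · rw [Function.update_of_ne (by omega), Function.update_self, Function.update_self]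
    simp only [e]
    simp only [← Finset.mul_sum]
    by_cases hz : reach P (pol ω) x0 0 (xs 0) *
        ∏ k ∈ Finset.Ico 0 n, (pol ω (xs k) (as_ k) * P (xs k) (as_ k) (xs (k + 1))) = 0
    · rw [hz, zero_mul]
    · have hx0 : layer (xs 0) = 0 := by
        have := left_ne_zero_of_mul hz
        simp only [reach] at this
        split_ifs at this with hh
        · rw [hh, h0]
        · simp at this
      have hlay : ∀ k ≤ n, layer (xs k) = k := by
        intro k
        induction k with
        | zero => intro _; exact hx0
        | succ k ih =>
          intro hk
          have h1 := Finset.prod_ne_zero_iff.1 (right_ne_zero_of_mul hz) k (by simp; omega)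
          rw [hP.2.1 _ _ _ (right_ne_zero_of_mul h1), ih (by omega)]
      have h1 : ∑ x, ∑ a, pol ω (xs n) a * P (xs n) a x = 1 := by
        rw [Finset.sum_comm]
        simp only [← Finset.mul_sum]
        rw [Finset.sum_congr rfl fun a _ => by
          rw [hP.2.2 (xs n) (by rw [hlay n le_rfl]; exact hn) a, mul_one]]
        exact (hpol ω).2 _
      rw [h1, mul_one]
  · intro x a ω
    simp only [cyl, Set.mem_ofPred_eq]
    constructor
    · rintro ⟨h1, h2⟩
      refine ⟨⟨fun k _ hk => ?_, fun k _ hk => ?_⟩, ?_, ?_⟩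
      · rw [h1 k (by omega) (by omega), Function.update_of_ne (by omega)]
      · rw [h2 k (by omega) (by omega), Function.update_of_ne (by omega)]
      · rw [h1 (n + 1) (by omega) (by omega), Function.update_self]
      · rw [h2 n (by omega) (by omega), Function.update_self]
    · rintro ⟨⟨h1, h2⟩, h3, h4⟩
      refine ⟨fun k _ hk => ?_, fun k _ hk => ?_⟩
      · rcases Nat.lt_or_ge n k with hh | hh
        · obtain rfl : k = n + 1 := by omega
          rw [h3, Function.update_self]
        · rw [h1 k (by omega) (by omega), Function.update_of_ne (by omega)]
      · rcases Nat.lt_or_ge k n with hh | hh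
        · rw [h2 k (by omega) (by omega), Function.update_of_ne (by omega)]
        · obtain rfl : k = n := by omega
          rw [h4, Function.update_self]

theorem law_left
    (hS : ∀ k x, MeasurableSet[m0] {ω | S ω k = x}) (hB : ∀ k a, MeasurableSet[m0] {ω | B ω k = a})
    (j n : ℕ) (hn : j < n) (h : LawS μ m P pol x0 S B j n) : LawS μ m P pol x0 S B (j + 1) n := by
  intro xs as_
  have := condExp_sum_ind μ m (cyl S B (j + 1) n xs as_)
    (fun x a => cyl S B j n (Function.update xs j x) (Function.update as_ j a))
    (fun ω => S ω j) (fun ω => B ω j) (fun x a => cyl_meas hS hB _ _ _ _) ?_ _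
    (fun x a => h _ _)
  · refine this.trans (Filter.Eventually.of_forall fun ω => ?_)
    have e : ∀ x a, reach P (pol ω) x0 j (Function.update xs j x j) *
        ∏ k ∈ Finset.Ico j n, (pol ω (Function.update xs j x k)
          (Function.update as_ j a k) * P (Function.update xs j x k)
          (Function.update as_ j a k) (Function.update xs j x (k + 1))) =
        (reach P (pol ω) x0 j x * pol ω x a * P x a (xs (j + 1))) *
        ∏ k ∈ Finset.Ico (j + 1) n, (pol ω (xs k) (as_ k) * P (xs k) (as_ k) (xs (k + 1))) := by
      intro x a
      rw [Finset.prod_eq_prod_Ico_succ_bot hn, ← mul_assoc]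
      congr 1
      · rw [Function.update_self, Function.update_self, Function.update_of_ne (by omega)]
        ring
      · refine Finset.prod_congr rfl fun k hk => ?_
        have hk' : j + 1 ≤ k := (Finset.mem_Ico.1 hk).1
        rw [Function.update_of_ne (by omega), Function.update_of_ne (by omega),
          Function.update_of_ne (by omega)]
    simp only [e]
    simp only [← Finset.sum_mul]
    rfl
  · intro x a ω
    simp only [cyl, Set.mem_ofPred_eq]
    constructor
    · rintro ⟨h1, h2⟩
      refine ⟨⟨fun k _ hk => ?_, fun k _ hk => ?_⟩, ?_, ?_⟩
      · rw [h1 k (by omega) (by omega), Function.update_of_ne (by omega)]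
      · rw [h2 k (by omega) (by omega), Function.update_of_ne (by omega)]
      · rw [h1 j (by omega) (by omega), Function.update_self]
      · rw [h2 j (by omega) (by omega), Function.update_self]
    · rintro ⟨⟨h1, h2⟩, h3, h4⟩
      refine ⟨fun k _ hk => ?_, fun k _ hk => ?_⟩
      · rcases Nat.lt_or_ge j k with hh | hh
        · rw [h1 k (by omega) (by omega), Function.update_of_ne (by omega)]
        · obtain rfl : k = j := by omega
          rw [h3, Function.update_self]
      · rcases Nat.lt_or_ge j k with hh | hh
        · rw [h2 k (by omega) (by omega), Function.update_of_ne (by omega)]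
        · obtain rfl : k = j := by omega
          rw [h4, Function.update_self]

theorem law_all (hP : validTrans layer J P) (hpol : ∀ ω, validPolicy (pol ω))
    (h0 : layer x0 = 0)
    (hS : ∀ k x, MeasurableSet[m0] {ω | S ω k = x}) (hB : ∀ k a, MeasurableSet[m0] {ω | B ω k = a})
    (h : LawS μ m P pol x0 S B 0 J) (k : ℕ) (hk : k < J) :
    LawS μ m P pol x0 S B k (k + 1) := by
  have h1 : ∀ d n, n + d = J → LawS μ m P pol x0 S B 0 n := by
    intro d
    induction d with
    | zero => intro n hn; obtain rfl : n = J := by omega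
              exact h
    | succ d ih => intro n hn; exact law_right μ m hP hpol h0 hS hB n (by omega) (ih (n + 1) (by omega))
  have h2 : ∀ j ≤ k, LawS μ m P pol x0 S B j (k + 1) := by
    intro j
    induction j with
    | zero => intro _; exact h1 (J - (k + 1)) (k + 1) (by omega)
    | succ j ih => intro hj; exact law_left μ m hS hB j (k + 1) (by omega) (ih (by omega))
  exact h2 k le_rfl

theorem law_triple (hP : validTrans layer J P) (hpol : ∀ ω, validPolicy (pol ω))
    (h0 : layer x0 = 0)
    (hS : ∀ k x, MeasurableSet[m0] {ω | S ω k = x}) (hB : ∀ k a, MeasurableSet[m0] {ω | B ω k = a})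
    (h : LawS μ m P pol x0 S B 0 J) (k : ℕ) (hk : k < J) (x : X) (a : A) (x' : X) :
    μ[Set.indicator {ω | S ω k = x ∧ B ω k = a ∧ S ω (k + 1) = x'} (fun _ => (1:ℝ)) | m] =ᵐ[μ]
      fun ω => reach P (pol ω) x0 k x * pol ω x a * P x a x' := by
  have h1 := law_all μ m hP hpol h0 hS hB h k hk (fun i => if i = k then x else x') (fun _ => a)
  have e : cyl S B k (k + 1) (fun i => if i = k then x else x') (fun _ => a) =
      {ω | S ω k = x ∧ B ω k = a ∧ S ω (k + 1) = x'} := by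
    ext ω
    simp only [cyl, Set.mem_ofPred_eq]
    constructor
    · rintro ⟨h1, h2⟩
      have a1 := h1 k le_rfl (by omega)
      have a2 := h1 (k + 1) (by omega) le_rfl
      have a3 := h2 k le_rfl (by omega)
      simp at a1 a2
      exact ⟨a1, a3, a2⟩
    · rintro ⟨h1, h2, h3⟩
      refine ⟨fun i hi hi2 => ?_, fun i hi hi2 => ?_⟩
      · rcases Nat.lt_or_ge k i with hh | hh
        · obtain rfl : i = k + 1 := by omega
          simp [h3]
        · obtain rfl : i = k := by omega
          simp [h1]
      · obtain rfl : i = k := by omega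
        exact h2
  rw [e] at h1
  refine h1.trans (Filter.Eventually.of_forall fun ω => ?_)
  simp [mul_assoc]

theorem law_pair (hP : validTrans layer J P) (hpol : ∀ ω, validPolicy (pol ω))
    (h0 : layer x0 = 0)
    (hS : ∀ k x, MeasurableSet[m0] {ω | S ω k = x}) (hB : ∀ k a, MeasurableSet[m0] {ω | B ω k = a})
    (h : LawS μ m P pol x0 S B 0 J) (k : ℕ) (hk : k < J) (x : X) (hx : layer x < J) (a : A) :
    μ[Set.indicator {ω | S ω k = x ∧ B ω k = a} (fun _ => (1:ℝ)) | m] =ᵐ[μ]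
      fun ω => reach P (pol ω) x0 k x * pol ω x a := by
  have := condExp_sum_ind (A := Unit) μ m {ω | S ω k = x ∧ B ω k = a}
    (fun x' _ => {ω | S ω k = x ∧ B ω k = a ∧ S ω (k + 1) = x'})
    (fun ω => S ω (k + 1)) (fun ω => ()) (fun x' _ => ?_) ?_ _
    (fun x' _ => law_triple μ m hP hpol h0 hS hB h k hk x a x')
  · refine this.trans (Filter.Eventually.of_forall fun ω => ?_)
    simp only [Finset.univ_unique, Finset.sum_const, Finset.card_singleton, one_smul]
    rw [← Finset.mul_sum, hP.2.2 x hx a, mul_one]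
  · exact (hS _ _).inter ((hB _ _).inter (hS _ _))
  · intro x' _ ω
    simp [and_assoc]

end law

end PartD


section PartE

variable {Ω : Type} {m0 : MeasurableSpace Ω}

theorem exp_quad {l : ℝ} (hl : |l| ≤ 1) : Real.exp l ≤ 1 + l + l ^ 2 := by
  have := Real.abs_exp_sub_one_sub_id_le hl
  have := (abs_le.1 this).2
  linarith

theorem mgf_trip (μ : Measure Ω) [IsProbabilityMeasure μ] (m : MeasurableSpace Ω)
    (hm : m ≤ m0) (E2 E3 : Set Ω) (hE : E3 ⊆ E2) (h2m : MeasurableSet[m0] E2)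
    (h3m : MeasurableSet[m0] E3) (w : Ω → ℝ) (hw : ∀ ω, 0 ≤ w ω) (p l : ℝ) (hp : 0 ≤ p)
    (hl : |l| ≤ 1)
    (h2 : μ[Set.indicator E2 (fun _ => (1:ℝ)) | m] =ᵐ[μ] w)
    (h3 : μ[Set.indicator E3 (fun _ => (1:ℝ)) | m] =ᵐ[μ] fun ω => w ω * p) :
    μ[fun ω => Real.exp (l * (Set.indicator E3 (fun _ => (1:ℝ)) ω -
        p * Set.indicator E2 (fun _ => (1:ℝ)) ω) -
        l ^ 2 * (p * Set.indicator E2 (fun _ => (1:ℝ)) ω)) | m] ≤ᵐ[μ] fun _ => (1:ℝ) := by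
  set q := Real.exp (-((l + l ^ 2) * p)) with hq
  have hi2 : Integrable (Set.indicator E2 (fun _ => (1:ℝ))) μ :=
    (integrable_const _).indicator h2m
  have hi3 : Integrable (Set.indicator E3 (fun _ => (1:ℝ))) μ :=
    (integrable_const _).indicator h3m
  have heq : (fun ω => Real.exp (l * (Set.indicator E3 (fun _ => (1:ℝ)) ω -
        p * Set.indicator E2 (fun _ => (1:ℝ)) ω) -
        l ^ 2 * (p * Set.indicator E2 (fun _ => (1:ℝ)) ω))) =
      (fun _ => (1:ℝ)) + ((q * (Real.exp l - 1)) • Set.indicator E3 (fun _ => (1:ℝ)) +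
        (q - 1) • Set.indicator E2 (fun _ => (1:ℝ))) := by
    classical
    funext ω
    simp only [Pi.add_apply, Pi.smul_apply, smul_eq_mul, Set.indicator_apply]
    by_cases h : ω ∈ E2
    · by_cases h' : ω ∈ E3
      · simp only [h, h', if_true]
        have : l * (1 - p * 1) - l ^ 2 * (p * 1) = -((l + l ^ 2) * p) + l := by ring
        rw [this, Real.exp_add, ← hq]; ring
      · simp only [h, h', if_true, if_false]
        have : l * (0 - p * 1) - l ^ 2 * (p * 1) = -((l + l ^ 2) * p) := by ring
        rw [this, ← hq]; ring
    · have h' : ω ∉ E3 := fun h' => h (hE h')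
      simp [h, h']
  rw [heq]
  have a1 := condExp_add (μ := μ) (integrable_const (1:ℝ))
    ((hi3.smul (q * (Real.exp l - 1))).add (hi2.smul (q - 1))) m
  have a2 := condExp_add (μ := μ) (hi3.smul (q * (Real.exp l - 1))) (hi2.smul (q - 1)) m
  have a3 := condExp_smul (μ := μ) (q * (Real.exp l - 1)) (Set.indicator E3 (fun _ => (1:ℝ))) m
  have a4 := condExp_smul (μ := μ) (q - 1) (Set.indicator E2 (fun _ => (1:ℝ))) m
  have a5 := condExp_const (μ := μ) hm (1:ℝ)
  filter_upwards [a1, a2, a3, a4, h2, h3] with ω b1 b2 b3 b4 b6 b7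
  rw [b1, Pi.add_apply, b2, Pi.add_apply, b3, b4, Pi.smul_apply, Pi.smul_apply, b6, b7, a5]
  simp only [smul_eq_mul]
  have k1 : q * (1 + (l + l ^ 2) * p) ≤ 1 := by
    have := Real.add_one_le_exp ((l + l ^ 2) * p)
    calc q * (1 + (l + l ^ 2) * p) ≤ q * Real.exp ((l + l ^ 2) * p) := by
          refine mul_le_mul_of_nonneg_left (by linarith) (Real.exp_pos _).le
      _ = 1 := by rw [hq, ← Real.exp_add]; simp
  have k2 : q * (Real.exp l - 1) * p ≤ q * (l + l ^ 2) * p := by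
    refine mul_le_mul_of_nonneg_right (mul_le_mul_of_nonneg_left ?_ (Real.exp_pos _).le) hp
    have := exp_quad hl; linarith
  have k3 : q * (Real.exp l - 1) * p + (q - 1) ≤ 0 := by nlinarith
  nlinarith [mul_nonneg (hw ω) (neg_nonneg.2 k3)]

theorem mgf_pair (μ : Measure Ω) [IsProbabilityMeasure μ] (m : MeasurableSpace Ω)
    (hm : m ≤ m0) (E2 : Set Ω) (h2m : MeasurableSet[m0] E2)
    (w : Ω → ℝ) (hw : ∀ ω, 0 ≤ w ω) (hw1 : ∀ ω, w ω ≤ 1) (hwm : StronglyMeasurable[m] w)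
    (h2 : μ[Set.indicator E2 (fun _ => (1:ℝ)) | m] =ᵐ[μ] w) :
    μ[fun ω => Real.exp (w ω / 2 - Set.indicator E2 (fun _ => (1:ℝ)) ω) | m]
      ≤ᵐ[μ] fun _ => (1:ℝ) := by
  have hi2 : Integrable (Set.indicator E2 (fun _ => (1:ℝ))) μ :=
    (integrable_const _).indicator h2m
  have heq : (fun ω => Real.exp (w ω / 2 - Set.indicator E2 (fun _ => (1:ℝ)) ω)) =
      (fun ω => Real.exp (w ω / 2)) * ((fun _ => (1:ℝ)) +
        (Real.exp (-1) - 1) • Set.indicator E2 (fun _ => (1:ℝ))) := by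
    classical
    funext ω
    simp only [Pi.add_apply, Pi.mul_apply, Pi.smul_apply, smul_eq_mul, Set.indicator_apply]
    by_cases h : ω ∈ E2
    · simp only [h, if_true]
      rw [sub_eq_add_neg, Real.exp_add]; ring
    · simp [h]
  rw [heq]
  have hem : StronglyMeasurable[m] (fun ω => Real.exp (w ω / 2)) :=
    (Real.continuous_exp.comp (continuous_id.div_const 2)).comp_stronglyMeasurable hwm
  have hi : Integrable ((fun _ => (1:ℝ)) +
        (Real.exp (-1) - 1) • Set.indicator E2 (fun _ => (1:ℝ))) μ :=
    (integrable_const _).add (hi2.smul _)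
  have him : Integrable ((fun ω => Real.exp (w ω / 2)) * ((fun _ => (1:ℝ)) +
        (Real.exp (-1) - 1) • Set.indicator E2 (fun _ => (1:ℝ)))) μ := by
    refine Integrable.bdd_mul (c := Real.exp 1) hi (hem.mono hm).aestronglyMeasurable ?_
    refine Filter.Eventually.of_forall fun ω => ?_
    rw [Real.norm_eq_abs, abs_of_nonneg (Real.exp_pos _).le]
    exact Real.exp_le_exp.2 (by linarith [hw1 ω])
  have a0 := condExp_mul_of_stronglyMeasurable_left hem him hi
  have a1 := condExp_add (μ := μ) (integrable_const (1:ℝ)) (hi2.smul (Real.exp (-1) - 1)) m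
  have a4 := condExp_smul (μ := μ) (Real.exp (-1) - 1) (Set.indicator E2 (fun _ => (1:ℝ))) m
  have a5 := condExp_const (μ := μ) hm (1:ℝ)
  filter_upwards [a0, a1, a4, h2] with ω b0 b1 b4 b6
  rw [b0, Pi.mul_apply, b1, Pi.add_apply, b4, Pi.smul_apply, b6, a5]
  simp only [smul_eq_mul]
  have k1 : Real.exp (-1) ≤ 1 / 2 := by
    rw [Real.exp_neg, one_div]
    exact inv_anti₀ (by norm_num) (by have := Real.add_one_le_exp (1:ℝ); linarith)
  have k2 : 1 + (Real.exp (-1) - 1) * w ω ≤ Real.exp (-(w ω / 2)) := by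
    have := Real.add_one_le_exp (-(w ω / 2))
    nlinarith [hw ω]
  calc Real.exp (w ω / 2) * (1 + (Real.exp (-1) - 1) * w ω)
      ≤ Real.exp (w ω / 2) * Real.exp (-(w ω / 2)) :=
        mul_le_mul_of_nonneg_left k2 (Real.exp_pos _).le
    _ = 1 := by rw [← Real.exp_add]; simp

variable {X A : Type} [Fintype X] [DecidableEq X] [Fintype A] [DecidableEq A]

theorem reach_meas (m : MeasurableSpace Ω) (P : X → A → X → ℝ) (pol : Ω → X → A → ℝ) (x0 : X)
    (hpol : ∀ x a, StronglyMeasurable[m] fun ω => pol ω x a) (k : ℕ) (x : X) :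
    StronglyMeasurable[m] fun ω => reach P (pol ω) x0 k x := by
  induction k generalizing x with
  | zero => exact stronglyMeasurable_const
  | succ k ih =>
    simp only [reach]
    exact Finset.stronglyMeasurable_fun_sum _ fun y _ => Finset.stronglyMeasurable_fun_sum _ fun a _ =>
      ((ih y).mul (hpol y a)).mul stronglyMeasurable_const

end PartE


section PartF

variable {X A Ω : Type} [Fintype X] [DecidableEq X] [Fintype A] [DecidableEq A]

noncomputable def lams (s : Bool) (p : ℝ) (n : ℕ) (L : ℝ) : ℝ :=
  if s = true then lamf p n L else -lamf p n L

theorem lams_abs (s : Bool) (p : ℝ) (n : ℕ) {L : ℝ} (hL : 0 < L) : |lams s p n L| ≤ 1 := by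
  have h1 := lamf_pos (p := p) (n := n) hL
  have h2 := lamf_le_one (p := p) (n := n) hL
  unfold lams
  split_ifs
  · rw [abs_of_pos h1]; exact h2
  · rw [abs_neg, abs_of_pos h1]; exact h2

theorem visits_le (layer : X → ℕ) (st : ℕ → Ω → ℕ → X) (ac : ℕ → Ω → ℕ → A)
    (t : ℕ) (x : X) (a : A) (ω : Ω) : visits layer st ac t x a ω ≤ t := by
  unfold visits
  refine (Finset.sum_le_sum (g := fun _ => 1) fun τ _ => ?_).trans (by simp)
  split_ifs <;> simp

theorem good_det {layer : X → ℕ} {J T : ℕ} {P : X → A → X → ℝ} {δ : ℝ}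
    (hP : validTrans layer J P) (hle : ∀ x, layer x ≤ J) (x0 : X) (h0 : layer x0 = 0)
    (pol l : ℕ → X → A → ℝ) (hpol : ∀ t, validPolicy (pol t))
    (hl : ∀ t x a, l t x a ∈ Set.Icc (0:ℝ) 1)
    (st : ℕ → Ω → ℕ → X) (ac : ℕ → Ω → ℕ → A)
    (Bt : ℕ → Ω → ℕ) (ω : Ω) (hB1 : Bt 1 ω = 0)
    (hBrec : ∀ t ∈ Finset.Icc 1 T,
        ((∃ k < J, max 1 (2 * visits layer st ac (Bt t ω) (st t ω k) (ac t ω k) ω)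
            ≤ visits layer st ac t (st t ω k) (ac t ω k) ω) →
          Bt (t + 1) ω = t) ∧
        (¬ (∃ k < J, max 1 (2 * visits layer st ac (Bt t ω) (st t ω k) (ac t ω k) ω)
            ≤ visits layer st ac t (st t ω k) (ac t ω k) ω) →
          Bt (t + 1) ω = Bt t ω))
    (L : ℝ) (hLdef : L = Real.log ((T * Fintype.card X * Fintype.card A : ℕ) / δ)) (hL : 1 ≤ L)
    (h1 : ∀ t ≤ T, ∀ n ≤ T, ∀ x a x', layer x < J → ∀ s : Bool,
      lams s (P x a x') n (4 * L) * ((transCount layer st ac t x a x' ω : ℝ) -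
        P x a x' * (visits layer st ac t x a ω : ℝ)) -
      (lams s (P x a x') n (4 * L)) ^ 2 * (P x a x' * (visits layer st ac t x a ω : ℝ)) ≤ 4 * L)
    (h2 : ∀ t ≤ T, ∀ x a, layer x < J →
      (∑ τ ∈ Finset.Icc 1 t, occ layer P (pol τ) x0 x a) / 2 -
        (visits layer st ac t x a ω : ℝ) ≤ 4 * L)
    (Q : ℕ → X → (X → A → X → ℝ))
    (hQ : ∀ t ∈ Finset.Icc 1 T, ∀ x : X, inConf layer J st ac T δ (Bt t ω) ω (Q t x)) :
    ∑ t ∈ Finset.Icc 1 T, ∑ x, ∑ a,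
      |occ layer (Q t x) (pol t) x0 x a - occ layer P (pol t) x0 x a| * l t x a ≤
    47 * (Fintype.card X * √((J + 1) *
      (∑ t ∈ Finset.Icc 1 T, lossOf layer P (pol t) x0 (l t)) *
      (Fintype.card A * (14 * L * Real.log (1 + T))))) +
    (47 + 4 * 47 ^ 2) * ((Fintype.card X : ℝ) ^ 5 * Fintype.card A *
      (14 * L * Real.log (1 + T))) := by
  have hL0 : 0 < L := by linarith
  have hlog : 0 ≤ Real.log (1 + T) := Real.log_nonneg (by simp)
  have hBle : ∀ t ∈ Finset.Icc 1 T, Bt t ω ≤ t - 1 ∧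
      ∀ x a, layer x < J → visits layer st ac (t - 1) x a ω ≤
        2 * visits layer st ac (Bt t ω) x a ω := by
    intro t ht
    rw [Finset.mem_Icc] at ht
    have := epoch_bound layer st ac Bt ω hB1 hBrec (t - 1) (by omega)
    rwa [Nat.sub_add_cancel ht.1] at this
  set r : ℕ → X → A → ℝ := fun t u b =>
    if layer u < J then L / max L (visits layer st ac (Bt t ω) u b ω : ℝ) else 0 with hr
  have hmax : ∀ y : ℝ, 0 < max L y := fun y => lt_of_lt_of_le hL0 (le_max_left _ _)
  refine deterministic (r := r) (Finset.Icc 1 T) hP hpol hle hl x0 h0 ?_ ?_ (by positivity)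
    (by norm_num) ?_ (fun t ht x => (hQ t ht x).1) ?_
  · intro t u b
    simp only [hr]
    split_ifs
    · exact div_nonneg hL0.le (hmax _).le
    · exact le_rfl
  · intro t u b
    simp only [hr]
    split_ifs
    · rw [div_le_one (hmax _)]; exact le_max_left _ _
    · norm_num
  · intro u b
    by_cases hu : layer u < J
    · simp only [hr, hu, if_true]
      refine k2_sum T (fun t => gmat J P (pol t) x0 u * pol t u b)
        (fun t => (visits layer st ac (Bt t ω) u b ω : ℝ)) L hL ?_ ?_ ?_
      · intro t
        exact mul_nonneg (gmat_nonneg hP (hpol t) _ _) ((hpol t).1 _ _)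
      · intro t
        refine mul_le_one₀ (gmat_le_one hP (hpol t) hle _ _) ((hpol t).1 _ _) ?_
        rw [← (hpol t).2 u]
        exact Finset.single_le_sum (f := fun b => pol t u b) (fun b _ => (hpol t).1 _ _)
          (Finset.mem_univ b)
      · intro t ht
        have e1 := h2 (t - 1) (by rw [Finset.mem_Icc] at ht; omega) u b hu
        have e2 := (hBle t ht).2 u b hu
        have e3 : (visits layer st ac (t - 1) u b ω : ℝ) ≤
          2 * (visits layer st ac (Bt t ω) u b ω : ℝ) := by exact_mod_cast e2
        simp only [occ_eq hP hle x0 h0] at e1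
        linarith
    · simp only [hr, hu, if_false, mul_zero, Finset.sum_const_zero]
      positivity
  · intro t ht y x a x'
    unfold ebd
    have hQv := (hQ t ht y).1
    split_ifs with hlay
    · have hx : layer x < J := by have := hle x'; omega
      have hrr : r t x a = L / max L (visits layer st ac (Bt t ω) x a ω : ℝ) := by
        simp only [hr, hx, if_true]
      rw [hrr]
      by_cases hN : L ≤ (visits layer st ac (Bt t ω) x a ω : ℝ)
      · rw [max_eq_right hN]
        have hB0 : Bt t ω ≠ 0 := by
          intro hb
          rw [hb] at hN
          simp [visits] at hN
          linarith
        have c1 := (hQ t ht y).2 hB0 x a x' hlay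
        have hBT : Bt t ω ≤ T := by
          have := (hBle t ht).1
          rw [Finset.mem_Icc] at ht
          omega
        have hvT : visits layer st ac (Bt t ω) x a ω ≤ T := (visits_le _ _ _ _ _ _ _).trans hBT
        have d1 := h1 (Bt t ω) hBT _ hvT x a x' hx true
        have d2 := h1 (Bt t ω) hBT _ hvT x a x' hx false
        simp only [lams, if_true] at d1
        simp only [lams, Bool.false_eq_true, if_false] at d2
        have d3 := dev_bound (hP.1 x a x') (by linarith) d1 d2
        refine conf_numeric (cnt := (transCount layer st ac (Bt t ω) x a x' ω : ℝ))
          (hP.1 x a x') hL hN (by positivity) d3 ?_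
        unfold confWidth empP at c1
        rw [← hLdef] at c1
        exact c1
      · push Not at hN
        rw [max_eq_left hN.le, div_self hL0.ne']
        have b1 := trans_le_one hQv hle x a x'
        have b2 := trans_le_one hP hle x a x'
        have b3 := hQv.1 x a x'
        have b4 := hP.1 x a x'
        have b5 : |Q t y x a x' - P x a x'| ≤ 1 := abs_le.2 ⟨by linarith, by linarith⟩
        have := Real.sqrt_nonneg (P x a x' * 1)
        linarith
    · have e1 : Q t y x a x' = 0 := by
        by_contra h; exact hlay (hQv.2.1 _ _ _ h)
      have e2 : P x a x' = 0 := by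
        by_contra h; exact hlay (hP.2.1 _ _ _ h)
      simp [e1, e2]

end PartF


section PartG

theorem final_arith {Xc Ac T J δ LT l1 ld L : ℝ} (hX : 2 ≤ Xc) (hA : 1 ≤ Ac) (hT : 2 ≤ T)
    (hJ : 1 ≤ J) (hLT : 0 ≤ LT) (hl1 : 1 ≤ l1) (hld : 1 ≤ ld) (hL : L = l1 + ld)
    (hlog : 0 ≤ Real.log (1 + T)) (hlog2 : Real.log (1 + T) ≤ 2 * l1) :
    47 * (Xc * √((J + 1) * LT * (Ac * (14 * L * Real.log (1 + T))))) +
      (47 + 4 * 47 ^ 2) * (Xc ^ 5 * Ac * (14 * L * Real.log (1 + T))) ≤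
    1000000 * l1 ^ 2 * (Xc * √(J * Ac * LT * ld) + Xc ^ 5 * Ac ^ 2 * ld +
      Xc ^ 4 * Ac * ld ^ 2) := by
  have hL2 : L ≤ 2 * (l1 * ld) := by rw [hL]; nlinarith
  have hL0 : 0 ≤ L := by linarith
  have hΛ : 14 * L * Real.log (1 + T) ≤ 56 * l1 ^ 2 * ld := by
    calc 14 * L * Real.log (1 + T) ≤ 14 * (2 * (l1 * ld)) * (2 * l1) := by gcongr
      _ = 56 * l1 ^ 2 * ld := by ring
  have hΛ0 : 0 ≤ 14 * L * Real.log (1 + T) := by positivity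
  generalize 14 * L * Real.log (1 + T) = Λ at *
  have s1 : √((J + 1) * LT * (Ac * Λ)) ≤ 11 * l1 * √(J * Ac * LT * ld) := by
    have e : 11 * l1 * √(J * Ac * LT * ld) = √((11 * l1) ^ 2 * (J * Ac * LT * ld)) := by
      rw [Real.sqrt_mul (x := (11 * l1) ^ 2) (by positivity), Real.sqrt_sq (by positivity)]
    rw [e]
    apply Real.sqrt_le_sqrt
    calc (J + 1) * LT * (Ac * Λ) ≤ (2 * J) * LT * (Ac * (56 * l1 ^ 2 * ld)) := by
          gcongr
          linarith
      _ = 112 * (l1 ^ 2 * (J * Ac * LT * ld)) := by ring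
      _ ≤ 121 * (l1 ^ 2 * (J * Ac * LT * ld)) := by
          gcongr
          norm_num
      _ = _ := by ring
  have hll : l1 ≤ l1 ^ 2 := by nlinarith
  have t1 : 47 * (Xc * √((J + 1) * LT * (Ac * Λ))) ≤
      1000000 * l1 ^ 2 * (Xc * √(J * Ac * LT * ld)) := by
    calc 47 * (Xc * √((J + 1) * LT * (Ac * Λ))) ≤ 47 * (Xc * (11 * l1 ^ 2 * √(J * Ac * LT * ld))) := by
          gcongr
          exact s1.trans (by gcongr)
      _ = 517 * (l1 ^ 2 * (Xc * √(J * Ac * LT * ld))) := by ring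
      _ ≤ 1000000 * (l1 ^ 2 * (Xc * √(J * Ac * LT * ld))) := by
          gcongr
          norm_num
      _ = _ := by ring
  have t2 : (47 + 4 * 47 ^ 2) * (Xc ^ 5 * Ac * Λ) ≤
      1000000 * l1 ^ 2 * (Xc ^ 5 * Ac ^ 2 * ld) := by
    have : Ac ≤ Ac ^ 2 := by nlinarith
    calc (47 + 4 * 47 ^ 2) * (Xc ^ 5 * Ac * Λ)
        ≤ (47 + 4 * 47 ^ 2) * (Xc ^ 5 * Ac ^ 2 * (56 * l1 ^ 2 * ld)) := by gcongr
      _ = 497448 * (l1 ^ 2 * (Xc ^ 5 * Ac ^ 2 * ld)) := by ring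
      _ ≤ 1000000 * (l1 ^ 2 * (Xc ^ 5 * Ac ^ 2 * ld)) := by
          gcongr
          norm_num
      _ = _ := by ring
  have t3 : 0 ≤ 1000000 * l1 ^ 2 * (Xc ^ 4 * Ac * ld ^ 2) := by positivity
  linarith

variable {X A Ω : Type} [Fintype X] [DecidableEq X] [Fintype A] [DecidableEq A]

theorem ev_trip {m0 : MeasurableSpace Ω} (μ : Measure Ω) [IsProbabilityMeasure μ]
    (F : ℕ → MeasurableSpace Ω) (hFmono : Monotone F) (hFle : ∀ t, F t ≤ m0)
    {layer : X → ℕ} {J T : ℕ} {P : X → A → X → ℝ}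
    (hP : validTrans layer J P) (hle : ∀ x, layer x ≤ J) (x0 : X) (h0 : layer x0 = 0)
    (pol : ℕ → Ω → X → A → ℝ) (hpol : ∀ t ω, validPolicy (pol t ω))
    (st : ℕ → Ω → ℕ → X) (ac : ℕ → Ω → ℕ → A)
    (hst : ∀ t k x, MeasurableSet[F (t + 1)] {ω | st t ω k = x})
    (hac : ∀ t k a, MeasurableSet[F (t + 1)] {ω | ac t ω k = a})
    (hlaw : ∀ t ∈ Finset.Icc 1 T, LawS μ (F t) P (pol t) x0 (st t) (ac t) 0 J)
    (x : X) (a : A) (x' : X) (hx : layer x < J) (l : ℝ) (hl : |l| ≤ 1)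
    (t : ℕ) (ht : t ≤ T) (L : ℝ) :
    μ {ω | L < l * ((transCount layer st ac t x a x' ω : ℝ) -
        P x a x' * (visits layer st ac t x a ω : ℝ)) -
      l ^ 2 * (P x a x' * (visits layer st ac t x a ω : ℝ))} ≤
      ENNReal.ofReal (Real.exp (-L)) := by
  classical
  set E2 : ℕ → Set Ω := fun τ => {ω | st τ ω (layer x) = x ∧ ac τ ω (layer x) = a} with hE2
  set E3 : ℕ → Set Ω := fun τ => {ω | st τ ω (layer x) = x ∧ ac τ ω (layer x) = a ∧
    st τ ω (layer x + 1) = x'} with hE3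
  have m2 : ∀ τ, MeasurableSet[F (τ + 1)] (E2 τ) := fun τ =>
    MeasurableSet.inter (hst _ _ _) (hac _ _ _)
  have m3 : ∀ τ, MeasurableSet[F (τ + 1)] (E3 τ) := fun τ =>
    MeasurableSet.inter (hst _ _ _) (MeasurableSet.inter (hac _ _ _) (hst _ _ _))
  have hp0 := hP.1 x a x'
  have hp1 := trans_le_one hP hle x a x'
  have hE : ∀ τ, E3 τ ⊆ E2 τ := fun τ ω h => ⟨h.1, h.2.1⟩
  obtain ⟨hl1, hl2⟩ := abs_le.1 hl
  have key := exp_markov μ F hFmono hFle T (fun τ ω =>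
    l * (Set.indicator (E3 τ) (fun _ => (1:ℝ)) ω -
        P x a x' * Set.indicator (E2 τ) (fun _ => (1:ℝ)) ω) -
        l ^ 2 * (P x a x' * Set.indicator (E2 τ) (fun _ => (1:ℝ)) ω)) 1 ?_ ?_ ?_ t ht L
  · refine (measure_mono ?_).trans key
    intro ω hω
    simp only [Set.mem_ofPred_eq] at hω ⊢
    refine hω.trans_le (le_of_eq ?_)
    have e3 : (transCount layer st ac t x a x' ω : ℝ) =
        ∑ τ ∈ Finset.Icc 1 t, Set.indicator (E3 τ) (fun _ => (1:ℝ)) ω := by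
      unfold transCount
      push_cast
      refine Finset.sum_congr rfl fun τ _ => ?_
      simp [Set.indicator_apply, hE3]
    have e2 : (visits layer st ac t x a ω : ℝ) =
        ∑ τ ∈ Finset.Icc 1 t, Set.indicator (E2 τ) (fun _ => (1:ℝ)) ω := by
      unfold visits
      push_cast
      refine Finset.sum_congr rfl fun τ _ => ?_
      simp [Set.indicator_apply, hE2]
    rw [e3, e2, Finset.sum_sub_distrib, ← Finset.mul_sum, ← Finset.mul_sum, ← Finset.mul_sum,
      Finset.sum_sub_distrib, ← Finset.mul_sum]
  · intro τ _
    have i2 : StronglyMeasurable[F (τ + 1)] (Set.indicator (E2 τ) (fun _ => (1:ℝ))) :=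
      stronglyMeasurable_const.indicator (m2 τ)
    have i3 : StronglyMeasurable[F (τ + 1)] (Set.indicator (E3 τ) (fun _ => (1:ℝ))) :=
      stronglyMeasurable_const.indicator (m3 τ)
    exact Real.continuous_exp.comp_stronglyMeasurable
      (((i3.sub (i2.const_mul _)).const_mul l).sub ((i2.const_mul _).const_mul _))
  · intro τ ω
    by_cases h2 : ω ∈ E2 τ
    · by_cases h3 : ω ∈ E3 τ
      · simp only [Set.indicator_apply, h2, h3, if_true]
        nlinarith [mul_nonneg (sq_nonneg l) hp0, mul_nonneg hp0 (sub_nonneg.2 hl2)]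
      · simp only [Set.indicator_apply, h2, h3, if_true, if_false]
        nlinarith [mul_nonneg (sq_nonneg l) hp0, mul_nonneg hp0 (sub_nonneg.2 hl2)]
    · have h3 : ω ∉ E3 τ := fun h => h2 (hE τ h)
      simp [h2, h3]
  · intro τ hτ
    have hS : ∀ k x, MeasurableSet[m0] {ω | st τ ω k = x} := fun k x => hFle _ _ (hst τ k x)
    have hB : ∀ k a, MeasurableSet[m0] {ω | ac τ ω k = a} := fun k a => hFle _ _ (hac τ k a)
    refine mgf_trip μ (F τ) (hFle τ) (E2 τ) (E3 τ) (hE τ) (hFle _ _ (m2 τ)) (hFle _ _ (m3 τ))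
      (fun ω => reach P (pol τ ω) x0 (layer x) x * pol τ ω x a) ?_ (P x a x') l hp0 hl
      (law_pair μ (F τ) hP (hpol τ) h0 hS hB (hlaw τ hτ) (layer x) hx x hx a)
      (law_triple μ (F τ) hP (hpol τ) h0 hS hB (hlaw τ hτ) (layer x) hx x a x')
    intro ω
    have := occ_eq (pol := pol τ ω) hP hle x0 h0 x a
    unfold occ at this
    rw [this]
    exact mul_nonneg (gmat_nonneg hP (hpol τ ω) _ _) ((hpol τ ω).1 _ _)

theorem ev_pair {m0 : MeasurableSpace Ω} (μ : Measure Ω) [IsProbabilityMeasure μ]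
    (F : ℕ → MeasurableSpace Ω) (hFmono : Monotone F) (hFle : ∀ t, F t ≤ m0)
    {layer : X → ℕ} {J T : ℕ} {P : X → A → X → ℝ}
    (hP : validTrans layer J P) (hle : ∀ x, layer x ≤ J) (x0 : X) (h0 : layer x0 = 0)
    (pol : ℕ → Ω → X → A → ℝ) (hpol : ∀ t ω, validPolicy (pol t ω))
    (hpolm : ∀ t x a, StronglyMeasurable[F t] fun ω => pol t ω x a)
    (st : ℕ → Ω → ℕ → X) (ac : ℕ → Ω → ℕ → A)
    (hst : ∀ t k x, MeasurableSet[F (t + 1)] {ω | st t ω k = x})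
    (hac : ∀ t k a, MeasurableSet[F (t + 1)] {ω | ac t ω k = a})
    (hlaw : ∀ t ∈ Finset.Icc 1 T, LawS μ (F t) P (pol t) x0 (st t) (ac t) 0 J)
    (x : X) (a : A) (hx : layer x < J)
    (t : ℕ) (ht : t ≤ T) (L : ℝ) :
    μ {ω | L < (∑ τ ∈ Finset.Icc 1 t, occ layer P (pol τ ω) x0 x a) / 2 -
        (visits layer st ac t x a ω : ℝ)} ≤
      ENNReal.ofReal (Real.exp (-L)) := by
  classical
  set E2 : ℕ → Set Ω := fun τ => {ω | st τ ω (layer x) = x ∧ ac τ ω (layer x) = a} with hE2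
  have m2 : ∀ τ, MeasurableSet[F (τ + 1)] (E2 τ) := fun τ =>
    MeasurableSet.inter (hst _ _ _) (hac _ _ _)
  have hwm : ∀ τ, StronglyMeasurable[F τ] fun ω => occ layer P (pol τ ω) x0 x a := fun τ =>
    (reach_meas (F τ) P (pol τ) x0 (hpolm τ) (layer x) x).mul (hpolm τ x a)
  have hw0 : ∀ τ ω, 0 ≤ occ layer P (pol τ ω) x0 x a := by
    intro τ ω
    rw [occ_eq hP hle x0 h0 x a]
    exact mul_nonneg (gmat_nonneg hP (hpol τ ω) _ _) ((hpol τ ω).1 _ _)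
  have hw1 : ∀ τ ω, occ layer P (pol τ ω) x0 x a ≤ 1 := by
    intro τ ω
    rw [occ_eq hP hle x0 h0 x a]
    refine mul_le_one₀ (gmat_le_one hP (hpol τ ω) hle _ _) ((hpol τ ω).1 _ _) ?_
    rw [← (hpol τ ω).2 x]
    exact Finset.single_le_sum (f := fun b => pol τ ω x b) (fun b _ => (hpol τ ω).1 _ _)
          (Finset.mem_univ a)
  have key := exp_markov μ F hFmono hFle T (fun τ ω =>
    occ layer P (pol τ ω) x0 x a / 2 - Set.indicator (E2 τ) (fun _ => (1:ℝ)) ω) 1 ?_ ?_ ?_ t ht L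
  · refine (measure_mono ?_).trans key
    intro ω hω
    simp only [Set.mem_ofPred_eq] at hω ⊢
    refine hω.trans_le (le_of_eq ?_)
    have e2 : (visits layer st ac t x a ω : ℝ) =
        ∑ τ ∈ Finset.Icc 1 t, Set.indicator (E2 τ) (fun _ => (1:ℝ)) ω := by
      unfold visits
      push_cast
      refine Finset.sum_congr rfl fun τ _ => ?_
      simp [Set.indicator_apply, hE2]
    rw [e2, Finset.sum_sub_distrib, Finset.sum_div]
  · intro τ _
    have i2 : StronglyMeasurable[F (τ + 1)] (Set.indicator (E2 τ) (fun _ => (1:ℝ))) :=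
      stronglyMeasurable_const.indicator (m2 τ)
    have i3 : StronglyMeasurable[F (τ + 1)] (fun ω => occ layer P (pol τ ω) x0 x a / 2) :=
      (continuous_id.div_const 2).comp_stronglyMeasurable ((hwm τ).mono (hFmono (by omega)))
    exact Real.continuous_exp.comp_stronglyMeasurable (i3.sub i2)
  · intro τ ω
    have : 0 ≤ Set.indicator (E2 τ) (fun _ => (1:ℝ)) ω :=
      Set.indicator_nonneg (fun _ _ => by norm_num) _
    have := hw1 τ ω
    linarith
  · intro τ hτ
    have hS : ∀ k x, MeasurableSet[m0] {ω | st τ ω k = x} := fun k x => hFle _ _ (hst τ k x)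
    have hB : ∀ k a, MeasurableSet[m0] {ω | ac τ ω k = a} := fun k a => hFle _ _ (hac τ k a)
    exact mgf_pair μ (F τ) (hFle τ) (E2 τ) (hFle _ _ (m2 τ)) _ (hw0 τ) (hw1 τ) (hwm τ)
      (law_pair μ (F τ) hP (hpol τ) h0 hS hB (hlaw τ hτ) (layer x) hx x hx a)

theorem union_le {m0 : MeasurableSpace Ω} (μ : Measure Ω) {ι : Type} (s : Finset ι)
    (E : ι → Set Ω) (e : ℝ) (he : 0 ≤ e) (h : ∀ i ∈ s, μ (E i) ≤ ENNReal.ofReal e) :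
    μ (⋃ i ∈ s, E i) ≤ ENNReal.ofReal (s.card * e) := by
  refine (measure_biUnion_finset_le s E).trans ?_
  refine (Finset.sum_le_sum h).trans ?_
  rw [Finset.sum_const, nsmul_eq_mul, ENNReal.ofReal_mul (by positivity)]
  simp

theorem law_start {m0 : MeasurableSpace Ω} (μ : Measure Ω) (m : MeasurableSpace Ω) {J : ℕ}
    {P : X → A → X → ℝ} {pol : Ω → X → A → ℝ} {x0 : X} {S : Ω → ℕ → X} {B : Ω → ℕ → A}
    (h : ∀ (xs : ℕ → X) (as_ : ℕ → A),
        μ[Set.indicator {ω | (∀ k ≤ J, S ω k = xs k) ∧ ∀ k < J, B ω k = as_ k}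
            (fun _ => (1 : ℝ)) | m]
          =ᵐ[μ] fun ω => if xs 0 = x0 then
            ∏ k ∈ Finset.range J, (pol ω (xs k) (as_ k) * P (xs k) (as_ k) (xs (k + 1)))
          else 0) : LawS μ m P pol x0 S B 0 J := by
  intro xs as_
  have e : cyl S B 0 J xs as_ = {ω | (∀ k ≤ J, S ω k = xs k) ∧ ∀ k < J, B ω k = as_ k} := by
    ext ω; simp [cyl]
  rw [e]
  refine (h xs as_).trans (Filter.Eventually.of_forall fun ω => ?_)
  simp only [reach, Finset.range_eq_Ico]
  split_ifs <;> simp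

end PartG

/-- **Lemma D.6: small-loss bound on occupancy-measure estimation error.**
In the setting of Algorithm 3 (episodic loop-free adversarial MDP with unknown
transition `P`, adapted policies `π_t` executed by the algorithm, trajectories drawn
from `(π_t, P)`, and epoch-based Bernstein confidence sets `𝒫_{i_t}` built from the
visit counters), with probability at least `1 − 6δ`, simultaneously for every episode
`t` and every collection of transition functions `{P_t^x}` with `P_t^x ∈ 𝒫_{i_t}`,
`∑_{t,x,a} |w^{P_t^x, π_t}(x,a) − w_t(x,a)| ℓ_t(x,a)
   = Õ(|X| √(J |A| L_T ln(1/δ)) + |X|⁵|A|² ln(1/δ) + |X|⁴|A| ln²(1/δ))`,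
where `w_t = w^{P,π_t}` and `L_T = ∑_t ⟨w_t, ℓ_t⟩`. -/
theorem occupancy_estimation_error_small_loss :
    ∃ c : ℝ, 0 < c ∧ ∃ k : ℕ,
    ∀ {X A : Type} [Fintype X] [DecidableEq X] [Fintype A] [DecidableEq A]
      [Nonempty X] [Nonempty A]
      (J T : ℕ) (hJ : 1 ≤ J) (hT : 2 ≤ T)
      (layer : X → ℕ) (x0 xJ : X)
      (hlayer0 : ∀ x, layer x = 0 ↔ x = x0)
      (hlayerJ : ∀ x, layer x = J ↔ x = xJ)
      (hlayerle : ∀ x, layer x ≤ J)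
      (P : X → A → X → ℝ) (hP : validTrans layer J P)
      (δ : ℝ) (hδ : δ ∈ Set.Ioo (0 : ℝ) 1)
      {Ω : Type} {m0 : MeasurableSpace Ω} (μ : Measure Ω)
      (hμ : IsProbabilityMeasure μ)
      (F : ℕ → MeasurableSpace Ω) (hFmono : Monotone F) (hFle : ∀ t, F t ≤ m0)
      -- adversarial losses, adapted and in [0,1]
      (ℓt : ℕ → Ω → X → A → ℝ)
      (hℓmeas : ∀ t x a, StronglyMeasurable[F t] fun ω => ℓt t ω x a)
      (hℓrange : ∀ t ω x a, ℓt t ω x a ∈ Set.Icc (0 : ℝ) 1)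
      -- the (adapted) policies executed by the algorithm
      (πt : ℕ → Ω → X → A → ℝ)
      (hπmeas : ∀ t x a, StronglyMeasurable[F t] fun ω => πt t ω x a)
      (hπvalid : ∀ t ω, validPolicy (πt t ω))
      -- the trajectories: adapted to F (t+1), starting at x0, with law (π_t, P)
      (st : ℕ → Ω → ℕ → X) (ac : ℕ → Ω → ℕ → A)
      (hst0 : ∀ t ω, st t ω 0 = x0)
      (hstmeas : ∀ t k x, MeasurableSet[F (t + 1)] {ω | st t ω k = x})
      (hacmeas : ∀ t k a, MeasurableSet[F (t + 1)] {ω | ac t ω k = a})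
      (hlaw : ∀ t ∈ Finset.Icc 1 T, ∀ (xs : ℕ → X) (as_ : ℕ → A),
        μ[Set.indicator {ω | (∀ k ≤ J, st t ω k = xs k) ∧ ∀ k < J, ac t ω k = as_ k}
            (fun _ => (1 : ℝ)) | F t]
          =ᵐ[μ] fun ω => if xs 0 = x0 then
            ∏ k ∈ Finset.range J, (πt t ω (xs k) (as_ k) * P (xs k) (as_ k) (xs (k + 1)))
          else 0)
      -- the epoch bookkeeping of Algorithm 3: `Bt t` is the last episode before the
      -- start of the epoch containing episode `t`; epochs change when a counter doubles
      (Bt : ℕ → Ω → ℕ) (hB1 : ∀ ω, Bt 1 ω = 0)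
      (hBrec : ∀ t ∈ Finset.Icc 1 T, ∀ ω,
        ((∃ k < J, max 1 (2 * visits layer st ac (Bt t ω) (st t ω k) (ac t ω k) ω)
            ≤ visits layer st ac t (st t ω k) (ac t ω k) ω) →
          Bt (t + 1) ω = t) ∧
        (¬ (∃ k < J, max 1 (2 * visits layer st ac (Bt t ω) (st t ω k) (ac t ω k) ω)
            ≤ visits layer st ac t (st t ω k) (ac t ω k) ω) →
          Bt (t + 1) ω = Bt t ω)),
    ENNReal.ofReal (1 - 6 * δ) ≤
      μ {ω | ∀ Pfam : ℕ → X → (X → A → X → ℝ),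
        (∀ t ∈ Finset.Icc 1 T, ∀ x : X,
          inConf layer J st ac T δ (Bt t ω) ω (Pfam t x)) →
        ∑ t ∈ Finset.Icc 1 T, ∑ x : X, ∑ a : A,
            |occ layer (Pfam t x) (πt t ω) x0 x a - occ layer P (πt t ω) x0 x a| *
              ℓt t ω x a
          ≤ c * (Real.log ((T * Fintype.card X * Fintype.card A : ℕ))) ^ k *
            ((Fintype.card X : ℝ) *
                Real.sqrt ((J : ℝ) * (Fintype.card A : ℝ) *
                  (∑ t ∈ Finset.Icc 1 T, lossOf layer P (πt t ω) x0 (ℓt t ω)) *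
                  Real.log (1 / δ)) +
              (Fintype.card X : ℝ) ^ 5 * (Fintype.card A : ℝ) ^ 2 * Real.log (1 / δ) +
              (Fintype.card X : ℝ) ^ 4 * (Fintype.card A : ℝ) *
                (Real.log (1 / δ)) ^ 2)} := by
  refine ⟨1000000, by norm_num, 2, ?_⟩
  intro X A _ _ _ _ _ _ J T hJ hT layer x0 xJ hlayer0 hlayerJ hlayerle P hP δ hδ Ω m0 μ hμ F hFmono
    hFle ℓt hℓmeas hℓrange πt hπmeas hπvalid st ac hst0 hstmeas hacmeas hlaw Bt hB1 hBrec
  obtain ⟨hδ0, hδ1⟩ := hδ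
  by_cases hδ6 : 1 / 6 ≤ δ
  · rw [ENNReal.ofReal_of_nonpos (by linarith)]
    exact zero_le
  push Not at hδ6
  have h0 : layer x0 = 0 := (hlayer0 x0).2 rfl
  have hXne : x0 ≠ xJ := by
    intro h
    have h1 := (hlayerJ xJ).2 rfl
    rw [← h, h0] at h1
    omega
  have hXc : (2:ℝ) ≤ Fintype.card X := by
    have : 1 < Fintype.card X := Fintype.one_lt_card_iff.2 ⟨x0, xJ, hXne⟩
    exact_mod_cast this
  have hAc : (1:ℝ) ≤ Fintype.card A := by
    exact_mod_cast (Fintype.card_pos : 0 < Fintype.card A)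
  have hTr : (2:ℝ) ≤ T := by exact_mod_cast hT
  have hJr : (1:ℝ) ≤ J := by exact_mod_cast hJ
  set M : ℝ := ((T * Fintype.card X * Fintype.card A : ℕ) : ℝ) with hM
  have hMeq : M = (T:ℝ) * Fintype.card X * Fintype.card A := by rw [hM]; push_cast; ring
  have hM2T : 2 * (T:ℝ) ≤ M := by
    rw [hMeq]
    calc 2 * (T:ℝ) = T * 2 * 1 := by ring
      _ ≤ (T:ℝ) * Fintype.card X * Fintype.card A := by gcongr
  have hM4 : 4 ≤ M := by linarith
  have hM0 : 0 < M := by linarith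
  have he1 := Real.exp_one_lt_three
  have hl1 : 1 ≤ Real.log M := by
    rw [Real.le_log_iff_exp_le hM0]; linarith
  have hld : 1 ≤ Real.log (1 / δ) := by
    rw [Real.le_log_iff_exp_le (by positivity)]
    have : 6 ≤ 1 / δ := by rw [le_div_iff₀ hδ0]; linarith
    linarith
  obtain ⟨L, hLdef⟩ : ∃ L, L = Real.log (M / δ) := ⟨_, rfl⟩
  have hLsum : L = Real.log M + Real.log (1 / δ) := by
    rw [hLdef, ← Real.log_mul (by positivity) (by positivity)]
    congr 1; field_simp
  have hL1 : 1 ≤ L := by linarith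
  have hlog0 : 0 ≤ Real.log (1 + (T:ℝ)) := Real.log_nonneg (by linarith)
  have hlog2 : Real.log (1 + (T:ℝ)) ≤ 2 * Real.log M := by
    have : Real.log (1 + (T:ℝ)) ≤ Real.log M := Real.log_le_log (by linarith) (by linarith)
    linarith
  have hlawS : ∀ t ∈ Finset.Icc 1 T, LawS μ (F t) P (πt t) x0 (st t) (ac t) 0 J :=
    fun t ht => law_start μ (F t) (hlaw t ht)
  -- bad events
  set S1 : Finset ((ℕ × ℕ) × (X × A × X × Bool)) :=
    (Finset.range (T + 1) ×ˢ Finset.range (T + 1)) ×ˢ Finset.univ with hS1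
  set S2 : Finset (ℕ × (X × A)) := Finset.range (T + 1) ×ˢ Finset.univ with hS2
  set E1 : ((ℕ × ℕ) × (X × A × X × Bool)) → Set Ω := fun i =>
    {ω | layer i.2.1 < J ∧ 4 * L < lams i.2.2.2.2 (P i.2.1 i.2.2.1 i.2.2.2.1) i.1.2 (4 * L) *
      ((transCount layer st ac i.1.1 i.2.1 i.2.2.1 i.2.2.2.1 ω : ℝ) -
        P i.2.1 i.2.2.1 i.2.2.2.1 * (visits layer st ac i.1.1 i.2.1 i.2.2.1 ω : ℝ)) -
      (lams i.2.2.2.2 (P i.2.1 i.2.2.1 i.2.2.2.1) i.1.2 (4 * L)) ^ 2 *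
        (P i.2.1 i.2.2.1 i.2.2.2.1 * (visits layer st ac i.1.1 i.2.1 i.2.2.1 ω : ℝ))} with hE1
  set E2 : (ℕ × (X × A)) → Set Ω := fun i =>
    {ω | layer i.2.1 < J ∧
      4 * L < (∑ τ ∈ Finset.Icc 1 i.1, occ layer P (πt τ ω) x0 i.2.1 i.2.2) / 2 -
        (visits layer st ac i.1 i.2.1 i.2.2 ω : ℝ)} with hE2
  have b1 : μ (⋃ i ∈ S1, E1 i) ≤ ENNReal.ofReal (S1.card * Real.exp (-(4 * L))) := by
    refine union_le μ S1 E1 _ (Real.exp_pos _).le ?_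
    rintro ⟨⟨t, n⟩, x, a, x', s⟩ hi
    simp only [hS1, Finset.mem_product, Finset.mem_range, Finset.mem_univ, and_true] at hi
    by_cases hx : layer x < J
    · refine (measure_mono ?_).trans (ev_trip μ F hFmono hFle hP hlayerle x0 h0 πt hπvalid st ac
        hstmeas hacmeas hlawS x a x' hx (lams s (P x a x') n (4 * L))
        (lams_abs s _ n (by linarith)) t (by omega) (4 * L))
      intro ω hω
      exact hω.2
    · have : E1 ((t, n), x, a, x', s) = ∅ := by
        ext ω
        simp only [hE1, Set.mem_ofPred_eq, Set.mem_empty_iff_false, iff_false]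
        exact fun h => hx h.1
      rw [this]; simp
  have b2 : μ (⋃ i ∈ S2, E2 i) ≤ ENNReal.ofReal (S2.card * Real.exp (-(4 * L))) := by
    refine union_le μ S2 E2 _ (Real.exp_pos _).le ?_
    rintro ⟨t, x, a⟩ hi
    simp only [hS2, Finset.mem_product, Finset.mem_range, Finset.mem_univ, and_true] at hi
    by_cases hx : layer x < J
    · refine (measure_mono ?_).trans (ev_pair μ F hFmono hFle hP hlayerle x0 h0 πt hπvalid hπmeas
        st ac hstmeas hacmeas hlawS x a hx t (by omega) (4 * L))
      intro ω hω
      exact hω.2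
    · have : E2 (t, x, a) = ∅ := by
        ext ω
        simp only [hE2, Set.mem_ofPred_eq, Set.mem_empty_iff_false, iff_false]
        exact fun h => hx h.1
      rw [this]; simp
  have hexp : Real.exp (-(4 * L)) = (δ / M) ^ 4 := by
    have : Real.exp L = M / δ := by rw [hLdef, Real.exp_log (by positivity)]
    rw [Real.exp_neg, mul_comm, Real.exp_mul, this]
    rw [show (4:ℝ) = ((4:ℕ):ℝ) by norm_num, Real.rpow_natCast]
    field_simp
  have hcard1 : (S1.card : ℝ) ≤ 8 * M ^ 2 := by
    have : (S1.card : ℝ) = ((T:ℝ) + 1) ^ 2 * (Fintype.card X ^ 2 * Fintype.card A * 2) := by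
      rw [hS1]
      simp only [Finset.card_product, Finset.card_range, Finset.card_univ, Fintype.card_prod,
        Fintype.card_bool]
      push_cast
      ring
    rw [this, hMeq]
    calc ((T:ℝ) + 1) ^ 2 * ((Fintype.card X:ℝ) ^ 2 * Fintype.card A * 2)
        ≤ (2 * (T:ℝ)) ^ 2 * ((Fintype.card X:ℝ) ^ 2 * (Fintype.card A) ^ 2 * 2) := by
          gcongr
          · linarith
          · nlinarith
      _ = 8 * ((T:ℝ) * Fintype.card X * Fintype.card A) ^ 2 := by ring
  have hcard2 : (S2.card : ℝ) ≤ 2 * M := by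
    have : (S2.card : ℝ) = ((T:ℝ) + 1) * (Fintype.card X * Fintype.card A) := by
      rw [hS2]
      simp only [Finset.card_product, Finset.card_range, Finset.card_univ, Fintype.card_prod]
      push_cast
      ring
    rw [this, hMeq]
    calc ((T:ℝ) + 1) * ((Fintype.card X:ℝ) * Fintype.card A)
        ≤ (2 * (T:ℝ)) * ((Fintype.card X:ℝ) * (Fintype.card A)) := by
          gcongr
          linarith
      _ = 2 * ((T:ℝ) * Fintype.card X * Fintype.card A) := by ring
  have htot : S1.card * Real.exp (-(4 * L)) + S2.card * Real.exp (-(4 * L)) ≤ 6 * δ := by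
    rw [← add_mul, hexp]
    have hc : (S1.card : ℝ) + S2.card ≤ M ^ 4 := by
      have q1 : 16 ≤ M ^ 2 := by nlinarith
      have q2 : 16 * M ^ 2 ≤ M ^ 4 := by
        calc 16 * M ^ 2 ≤ M ^ 2 * M ^ 2 := by gcongr
          _ = M ^ 4 := by ring
      have q3 : 4 * M ≤ M ^ 2 := by nlinarith
      linarith
    have hd : δ ^ 4 ≤ δ := by
      calc δ ^ 4 ≤ δ ^ 1 := pow_le_pow_of_le_one hδ0.le hδ1.le (by norm_num)
        _ = δ := pow_one δ
    calc ((S1.card : ℝ) + S2.card) * (δ / M) ^ 4 ≤ M ^ 4 * (δ / M) ^ 4 := by gcongr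
      _ = δ ^ 4 := by field_simp
      _ ≤ 6 * δ := by linarith
  have hcov : (Set.univ : Set Ω) ⊆ {ω | ∀ Pfam : ℕ → X → (X → A → X → ℝ),
        (∀ t ∈ Finset.Icc 1 T, ∀ x : X,
          inConf layer J st ac T δ (Bt t ω) ω (Pfam t x)) →
        ∑ t ∈ Finset.Icc 1 T, ∑ x : X, ∑ a : A,
            |occ layer (Pfam t x) (πt t ω) x0 x a - occ layer P (πt t ω) x0 x a| *
              ℓt t ω x a
          ≤ 1000000 * (Real.log M) ^ 2 *
            ((Fintype.card X : ℝ) *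
                Real.sqrt ((J : ℝ) * (Fintype.card A : ℝ) *
                  (∑ t ∈ Finset.Icc 1 T, lossOf layer P (πt t ω) x0 (ℓt t ω)) *
                  Real.log (1 / δ)) +
              (Fintype.card X : ℝ) ^ 5 * (Fintype.card A : ℝ) ^ 2 * Real.log (1 / δ) +
              (Fintype.card X : ℝ) ^ 4 * (Fintype.card A : ℝ) *
                (Real.log (1 / δ)) ^ 2)} ∪ ((⋃ i ∈ S1, E1 i) ∪ (⋃ i ∈ S2, E2 i)) := by
    intro ω _
    by_cases hb1 : ω ∈ ⋃ i ∈ S1, E1 i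
    · exact Or.inr (Or.inl hb1)
    by_cases hb2 : ω ∈ ⋃ i ∈ S2, E2 i
    · exact Or.inr (Or.inr hb2)
    refine Or.inl ?_
    intro Q hQ
    have g1 : ∀ t ≤ T, ∀ n ≤ T, ∀ x a x', layer x < J → ∀ s : Bool,
        lams s (P x a x') n (4 * L) * ((transCount layer st ac t x a x' ω : ℝ) -
          P x a x' * (visits layer st ac t x a ω : ℝ)) -
        (lams s (P x a x') n (4 * L)) ^ 2 *
          (P x a x' * (visits layer st ac t x a ω : ℝ)) ≤ 4 * L := by
      intro t ht n hn x a x' hx s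
      by_contra hcon
      push Not at hcon
      refine hb1 (Set.mem_biUnion (x := ((t, n), x, a, x', s)) ?_ ⟨hx, hcon⟩)
      simp [hS1]; omega
    have g2 : ∀ t ≤ T, ∀ x a, layer x < J →
        (∑ τ ∈ Finset.Icc 1 t, occ layer P (πt τ ω) x0 x a) / 2 -
          (visits layer st ac t x a ω : ℝ) ≤ 4 * L := by
      intro t ht x a hx
      by_contra hcon
      push Not at hcon
      refine hb2 (Set.mem_biUnion (x := (t, x, a)) ?_ ⟨hx, hcon⟩)
      simp [hS2]; omega
    refine (good_det hP hlayerle x0 h0 (fun t => πt t ω) (fun t => ℓt t ω)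
      (fun t => hπvalid t ω) (fun t => hℓrange t ω) st ac Bt ω (hB1 ω)
      (fun t ht => hBrec t ht ω) L hLdef hL1 g1 g2 Q hQ).trans ?_
    refine final_arith (δ := δ) hXc hAc hTr hJr ?_ hl1 hld hLsum hlog0 hlog2
    refine Finset.sum_nonneg fun t _ => Finset.sum_nonneg fun x _ => Finset.sum_nonneg fun a _ => ?_
    refine mul_nonneg ?_ (hℓrange t ω x a).1
    rw [occ_eq hP hlayerle x0 h0 x a]
    exact mul_nonneg (gmat_nonneg hP (hπvalid t ω) _ _) ((hπvalid t ω).1 _ _)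
  have hfin := (measure_mono hcov).trans (measure_union_le (μ := μ) _ _)
  rw [measure_univ] at hfin
  have hbad : μ ((⋃ i ∈ S1, E1 i) ∪ (⋃ i ∈ S2, E2 i)) ≤ ENNReal.ofReal (6 * δ) := by
    refine (measure_union_le _ _).trans ((add_le_add b1 b2).trans ?_)
    rw [← ENNReal.ofReal_add (by positivity) (by positivity)]
    exact ENNReal.ofReal_le_ofReal htot
  rw [ENNReal.ofReal_sub _ (by positivity), ENNReal.ofReal_one, tsub_le_iff_right]
  exact hfin.trans (by gcongr)
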